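/- There exists a constant C depending only on T, q, C₀ and on the initial data ρ₀,u₀,w₀,b₀,θ₀ — specifically on upper bounds for their H²((0,1))-norms, an upper bound for ∫₀¹ ρ₀(|ln ρ₀| + |ln θ₀|) dx, and a positive lower bound for ∫₀¹ ρ₀ dx — but not on the pointwise lower bounds of ρ₀ and θ₀, such that every smooth solution (ρ,u,w,b,θ) of the planar compressible MHD system on Q_T satisfies ∬_{Q_T} (u_x² + |w_x|² + |b_x|²) dx dt ≤ C. -/

import Mathlib

open Real MeasureTheory Set

noncomputable section

/-- Partial derivative in the first (spatial) variable of `f : ℝ → ℝ → ℝ`, `f x t`. -/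
def pdx (f : ℝ → ℝ → ℝ) : ℝ → ℝ → ℝ := fun x t => deriv (fun y => f y t) x

/-- Partial derivative in the second (time) variable. -/
def pdt (f : ℝ → ℝ → ℝ) : ℝ → ℝ → ℝ := fun x t => deriv (fun s => f x s) t

/-- The `L²(0,1)` norm of a function. -/
def L2norm (f : ℝ → ℝ) : ℝ := Real.sqrt (∫ x in (0:ℝ)..1, (f x) ^ 2)

/-- The `H²(0,1)` norm of a (smooth) function. -/
def H2norm (f : ℝ → ℝ) : ℝ :=
  Real.sqrt (∫ x in (0:ℝ)..1, (f x) ^ 2 + (deriv f x) ^ 2 + (deriv (deriv f) x) ^ 2)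

/-- A smooth solution of the planar compressible MHD system (all physical constants
normalized to `1`, perfect-gas pressure `P = ρθ`, heat conductivity `κ`) on
`Q_T = [0,1] × [0,T]`:  `ρ, u, θ` are scalar fields, `w, b` are `ℝ²`-valued fields
(given by their two components), everything is smooth, `ρ > 0` and `θ > 0` on `Q_T`,
the five PDEs hold on `Q_T`, and the boundary conditions
`u = 0`, `w = 0`, `b = 0`, `θ_x = 0` hold at `x = 0` and `x = 1`. -/
structure MHDSol (T : ℝ) (κ : ℝ → ℝ) where
  ρ : ℝ → ℝ → ℝ
  u : ℝ → ℝ → ℝ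
  θ : ℝ → ℝ → ℝ
  w : Fin 2 → ℝ → ℝ → ℝ
  b : Fin 2 → ℝ → ℝ → ℝ
  smooth_ρ : ContDiff ℝ (⊤ : ℕ∞) (Function.uncurry ρ)
  smooth_u : ContDiff ℝ (⊤ : ℕ∞) (Function.uncurry u)
  smooth_θ : ContDiff ℝ (⊤ : ℕ∞) (Function.uncurry θ)
  smooth_w : ∀ i, ContDiff ℝ (⊤ : ℕ∞) (Function.uncurry (w i))
  smooth_b : ∀ i, ContDiff ℝ (⊤ : ℕ∞) (Function.uncurry (b i))
  ρ_pos : ∀ x ∈ Set.Icc (0:ℝ) 1, ∀ t ∈ Set.Icc (0:ℝ) T, 0 < ρ x t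
  θ_pos : ∀ x ∈ Set.Icc (0:ℝ) 1, ∀ t ∈ Set.Icc (0:ℝ) T, 0 < θ x t
  eq_mass : ∀ x ∈ Set.Icc (0:ℝ) 1, ∀ t ∈ Set.Icc (0:ℝ) T,
    pdt ρ x t + pdx (fun x t => ρ x t * u x t) x t = 0
  eq_mom : ∀ x ∈ Set.Icc (0:ℝ) 1, ∀ t ∈ Set.Icc (0:ℝ) T,
    pdt (fun x t => ρ x t * u x t) x t
      + pdx (fun x t =>
          ρ x t * (u x t) ^ 2 + ρ x t * θ x t + (∑ i, (b i x t) ^ 2) / 2) x t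
      = pdx (pdx u) x t
  eq_w : ∀ i, ∀ x ∈ Set.Icc (0:ℝ) 1, ∀ t ∈ Set.Icc (0:ℝ) T,
    pdt (fun x t => ρ x t * w i x t) x t
      + pdx (fun x t => ρ x t * u x t * w i x t - b i x t) x t
      = pdx (pdx (w i)) x t
  eq_b : ∀ i, ∀ x ∈ Set.Icc (0:ℝ) 1, ∀ t ∈ Set.Icc (0:ℝ) T,
    pdt (b i) x t + pdx (fun x t => u x t * b i x t - w i x t) x t
      = pdx (pdx (b i)) x t
  eq_θ : ∀ x ∈ Set.Icc (0:ℝ) 1, ∀ t ∈ Set.Icc (0:ℝ) T,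
    pdt (fun x t => ρ x t * θ x t) x t
      + pdx (fun x t => ρ x t * u x t * θ x t) x t
      - pdx (fun x t => κ (θ x t) * pdx θ x t) x t
      = (pdx u x t) ^ 2 + (∑ i, (pdx (w i) x t) ^ 2) + (∑ i, (pdx (b i) x t) ^ 2)
        - ρ x t * θ x t * pdx u x t
  bc_u : ∀ t ∈ Set.Icc (0:ℝ) T, u 0 t = 0 ∧ u 1 t = 0
  bc_w : ∀ i, ∀ t ∈ Set.Icc (0:ℝ) T, w i 0 t = 0 ∧ w i 1 t = 0
  bc_b : ∀ i, ∀ t ∈ Set.Icc (0:ℝ) T, b i 0 t = 0 ∧ b i 1 t = 0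
  bc_θ : ∀ t ∈ Set.Icc (0:ℝ) T, pdx θ 0 t = 0 ∧ pdx θ 1 t = 0

/-- The heat conductivity `κ` is `C²` on `[0,∞)` and satisfies
`C₀⁻¹ (1 + s^q) ≤ κ(s) ≤ C₀ (1 + s^q)` there. -/
def KappaHyp (q C₀ : ℝ) (κ : ℝ → ℝ) : Prop :=
  ContDiffOn ℝ 2 κ (Set.Ici 0) ∧
  (∀ s : ℝ, 0 ≤ s → C₀⁻¹ * (1 + s ^ q) ≤ κ s) ∧
  (∀ s : ℝ, 0 ≤ s → κ s ≤ C₀ * (1 + s ^ q))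

/-- Bounds on the initial data: `A` is an upper bound for the `H²(0,1)` norms of
`ρ₀, u₀, w₀, b₀, θ₀`, `B` is an upper bound for `∫₀¹ ρ₀ (|ln ρ₀| + |ln θ₀|) dx`, and
`M` is a (positive) lower bound for the total mass `∫₀¹ ρ₀ dx`. -/
def InitBounds {T : ℝ} {κ : ℝ → ℝ} (sol : MHDSol T κ) (A B M : ℝ) : Prop :=
  H2norm (fun x => sol.ρ x 0) ≤ A ∧ H2norm (fun x => sol.u x 0) ≤ A ∧
  H2norm (fun x => sol.θ x 0) ≤ A ∧
  (∀ i, H2norm (fun x => sol.w i x 0) ≤ A) ∧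
  (∀ i, H2norm (fun x => sol.b i x 0) ≤ A) ∧
  (∫ x in (0:ℝ)..1, sol.ρ x 0 * (|Real.log (sol.ρ x 0)| + |Real.log (sol.θ x 0)|)) ≤ B ∧
  M ≤ ∫ x in (0:ℝ)..1, sol.ρ x 0

/-- `G` is an upper bound for the `L²(0,1)` norms of the compatibility functions
`g₁ = (∂ₓ²u₀ − ∂ₓ(ρ₀θ₀ + |b₀|²/2))/√ρ₀`, `g₂ = (∂ₓ²w₀ − ∂ₓb₀)/√ρ₀`,
`g₃ = (∂ₓ(κ(θ₀)∂ₓθ₀) + (∂ₓu₀)² + |∂ₓw₀|² + |∂ₓb₀|²)/√ρ₀`. -/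
def CompatBounds {T : ℝ} {κ : ℝ → ℝ} (sol : MHDSol T κ) (G : ℝ) : Prop :=
  L2norm (fun x =>
      (pdx (pdx sol.u) x 0
        - pdx (fun x t => sol.ρ x t * sol.θ x t + (∑ i, (sol.b i x t) ^ 2) / 2) x 0)
      / Real.sqrt (sol.ρ x 0)) ≤ G ∧
  (∀ i, L2norm (fun x =>
      (pdx (pdx (sol.w i)) x 0 - pdx (sol.b i) x 0) / Real.sqrt (sol.ρ x 0)) ≤ G) ∧
  L2norm (fun x =>
      (pdx (fun x t => κ (sol.θ x t) * pdx sol.θ x t) x 0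
        + (pdx sol.u x 0) ^ 2 + (∑ i, (pdx (sol.w i) x 0) ^ 2)
        + (∑ i, (pdx (sol.b i) x 0) ^ 2))
      / Real.sqrt (sol.ρ x 0)) ≤ G

/-! ### Generic helpers: continuous functions on the rectangle -/

/-- continuity on the rectangle -/
def CQ (T : ℝ) (h : ℝ → ℝ → ℝ) : Prop :=
  ContinuousOn (Function.uncurry h) (Icc (0:ℝ) 1 ×ˢ Icc (0:ℝ) T)

/-- double integral -/
def II (T : ℝ) (h : ℝ → ℝ → ℝ) : ℝ := ∫ s in (0:ℝ)..T, ∫ y in (0:ℝ)..1, h y s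

/-- clamping -/
def cl (a b x : ℝ) : ℝ := max a (min b x)

lemma cl_cont (a b : ℝ) : Continuous (cl a b) := by unfold cl; fun_prop

lemma cl_mem {a b : ℝ} (h : a ≤ b) (x : ℝ) : cl a b x ∈ Icc a b := by
  unfold cl; constructor
  · exact le_max_left _ _
  · exact max_le h (min_le_left _ _)

lemma cl_eq {a b x : ℝ} (h : x ∈ Icc a b) : cl a b x = x := by
  unfold cl; rw [min_eq_right h.2, max_eq_right h.1]

lemma CQ.ext {T : ℝ} (hT : 0 ≤ T) {h : ℝ → ℝ → ℝ} (hh : CQ T h) :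
    ∃ k : ℝ → ℝ → ℝ, Continuous (Function.uncurry k) ∧
      ∀ x ∈ Icc (0:ℝ) 1, ∀ t ∈ Icc (0:ℝ) T, k x t = h x t := by
  refine ⟨fun x t => h (cl 0 1 x) (cl 0 T t), ?_, ?_⟩
  · have h1 : Continuous (fun p : ℝ × ℝ => (cl 0 1 p.1, cl 0 T p.2)) :=
      ((cl_cont 0 1).comp continuous_fst).prodMk ((cl_cont 0 T).comp continuous_snd)
    exact hh.comp_continuous h1 (fun p => ⟨cl_mem zero_le_one _, cl_mem hT _⟩)
  · intro x hx t ht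
    simp only [cl_eq hx, cl_eq ht]

lemma integral_congr01 {f g : ℝ → ℝ} (h : ∀ x ∈ Icc (0:ℝ) 1, f x = g x) :
    ∫ x in (0:ℝ)..1, f x = ∫ x in (0:ℝ)..1, g x := by
  apply intervalIntegral.integral_congr
  intro x hx
  rw [uIcc_of_le zero_le_one] at hx
  exact h x hx

lemma integral_congrT {T : ℝ} (hT : 0 ≤ T) {f g : ℝ → ℝ} (h : ∀ x ∈ Icc (0:ℝ) T, f x = g x) :
    ∫ x in (0:ℝ)..T, f x = ∫ x in (0:ℝ)..T, g x := by
  apply intervalIntegral.integral_congr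
  intro x hx
  rw [uIcc_of_le hT] at hx
  exact h x hx

lemma CQ.x {T : ℝ} {h : ℝ → ℝ → ℝ} (hh : CQ T h) {t : ℝ} (ht : t ∈ Icc (0:ℝ) T) :
    ContinuousOn (fun x => h x t) (Icc 0 1) := by
  have : ContinuousOn (fun x : ℝ => ((x, t) : ℝ × ℝ)) (Icc 0 1) := by fun_prop
  exact hh.comp this (fun x hx => ⟨hx, ht⟩)

lemma CQ.t {T : ℝ} {h : ℝ → ℝ → ℝ} (hh : CQ T h) {x : ℝ} (hx : x ∈ Icc (0:ℝ) 1) :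
    ContinuousOn (fun t => h x t) (Icc 0 T) := by
  have : ContinuousOn (fun t : ℝ => ((x, t) : ℝ × ℝ)) (Icc 0 T) := by fun_prop
  exact hh.comp this (fun t ht => ⟨hx, ht⟩)

lemma CQ.int {T : ℝ} {h : ℝ → ℝ → ℝ} (hh : CQ T h) {t : ℝ} (ht : t ∈ Icc (0:ℝ) T) :
    IntervalIntegrable (fun x => h x t) volume 0 1 :=
  (hh.x ht).intervalIntegrable_of_Icc zero_le_one

lemma CQ.intt {T : ℝ} (hT : 0 ≤ T) {h : ℝ → ℝ → ℝ} (hh : CQ T h) {x : ℝ}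
    (hx : x ∈ Icc (0:ℝ) 1) :
    IntervalIntegrable (fun t => h x t) volume 0 T :=
  (hh.t hx).intervalIntegrable_of_Icc hT

lemma CQ.inner {T : ℝ} (hT : 0 ≤ T) {h : ℝ → ℝ → ℝ} (hh : CQ T h) :
    ContinuousOn (fun t => ∫ x in (0:ℝ)..1, h x t) (Icc 0 T) := by
  obtain ⟨k, hk, he⟩ := hh.ext hT
  have h1 : Continuous (fun t => ∫ x in (0:ℝ)..1, k x t) := by
    apply intervalIntegral.continuous_parametric_intervalIntegral_of_continuous' (f := fun t x => k x t)
    exact hk.comp continuous_swap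
  refine h1.continuousOn.congr ?_
  intro t ht
  exact integral_congr01 (fun x hx => (he x hx t ht).symm)

lemma CQ.innerI {T : ℝ} (hT : 0 ≤ T) {h : ℝ → ℝ → ℝ} (hh : CQ T h) :
    IntervalIntegrable (fun t => ∫ x in (0:ℝ)..1, h x t) volume 0 T :=
  (hh.inner hT).intervalIntegrable_of_Icc hT

lemma CQ.mono {T S : ℝ} (hS : S ≤ T) {h : ℝ → ℝ → ℝ} (hh : CQ T h) : CQ S h := by
  apply ContinuousOn.mono hh
  exact Set.prod_mono le_rfl (Icc_subset_Icc_right hS)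

lemma swap_cont {k : ℝ → ℝ → ℝ} (hk : Continuous (Function.uncurry k)) (a b c d : ℝ) :
    ∫ t in a..b, ∫ x in c..d, k x t = ∫ x in c..d, ∫ t in a..b, k x t := by
  apply MeasureTheory.intervalIntegral_intervalIntegral_swap (F := fun t x => k x t)
  have h1 : Continuous (Function.uncurry (fun t x => k x t)) := hk.comp continuous_swap
  refine (h1.continuousOn.integrableOn_compact
    (isCompact_uIcc.prod isCompact_uIcc)).mono_set (Set.prod_mono uIoc_subset_uIcc uIoc_subset_uIcc)

lemma CQ.swap {T : ℝ} (hT : 0 ≤ T) {h : ℝ → ℝ → ℝ} (hh : CQ T h) :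
    II T h = ∫ x in (0:ℝ)..1, ∫ t in (0:ℝ)..T, h x t := by
  obtain ⟨k, hk, he⟩ := hh.ext hT
  have e1 : II T h = II T k := by
    apply integral_congrT hT
    intro t ht
    exact integral_congr01 (fun x hx => (he x hx t ht).symm)
  rw [e1]
  unfold II
  rw [swap_cont hk]
  apply integral_congr01
  intro x hx
  exact integral_congrT hT (fun t ht => he x hx t ht)

lemma II_congr {T : ℝ} (hT : 0 ≤ T) {f g : ℝ → ℝ → ℝ}
    (h : ∀ x ∈ Icc (0:ℝ) 1, ∀ t ∈ Icc (0:ℝ) T, f x t = g x t) : II T f = II T g :=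
  integral_congrT hT fun t ht => integral_congr01 fun x hx => h x hx t ht

lemma II_add {T : ℝ} (hT : 0 ≤ T) {f g : ℝ → ℝ → ℝ} (hf : CQ T f) (hg : CQ T g) :
    II T (fun x t => f x t + g x t) = II T f + II T g := by
  unfold II
  rw [← intervalIntegral.integral_add (hf.innerI hT) (hg.innerI hT)]
  apply integral_congrT hT
  intro t ht
  exact intervalIntegral.integral_add (hf.int ht) (hg.int ht)

lemma II_cmul {T : ℝ} (c : ℝ) (f : ℝ → ℝ → ℝ) :
    II T (fun x t => c * f x t) = c * II T f := by
  unfold II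
  simp only [intervalIntegral.integral_const_mul]

lemma II_mono {T : ℝ} (hT : 0 ≤ T) {f g : ℝ → ℝ → ℝ} (hf : CQ T f) (hg : CQ T g)
    (h : ∀ x ∈ Icc (0:ℝ) 1, ∀ t ∈ Icc (0:ℝ) T, f x t ≤ g x t) : II T f ≤ II T g := by
  apply intervalIntegral.integral_mono_on hT (hf.innerI hT) (hg.innerI hT)
  intro t ht
  apply intervalIntegral.integral_mono_on zero_le_one (hf.int ht) (hg.int ht)
  intro x hx
  exact h x hx t ht

lemma CQ.add {T : ℝ} {f g : ℝ → ℝ → ℝ} (hf : CQ T f) (hg : CQ T g) :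
    CQ T (fun x t => f x t + g x t) := ContinuousOn.add hf hg
lemma CQ.sub {T : ℝ} {f g : ℝ → ℝ → ℝ} (hf : CQ T f) (hg : CQ T g) :
    CQ T (fun x t => f x t - g x t) := ContinuousOn.sub hf hg
lemma CQ.mul {T : ℝ} {f g : ℝ → ℝ → ℝ} (hf : CQ T f) (hg : CQ T g) :
    CQ T (fun x t => f x t * g x t) := ContinuousOn.mul hf hg
lemma CQ.cmul {T : ℝ} (c : ℝ) {f : ℝ → ℝ → ℝ} (hf : CQ T f) :
    CQ T (fun x t => c * f x t) := ContinuousOn.mul continuousOn_const hf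
lemma CQ.const {T : ℝ} (c : ℝ) : CQ T (fun _ _ => c) := continuousOn_const
lemma CQ.neg {T : ℝ} {f : ℝ → ℝ → ℝ} (hf : CQ T f) :
    CQ T (fun x t => - f x t) := ContinuousOn.neg hf
lemma CQ.pow {T : ℝ} {f : ℝ → ℝ → ℝ} (hf : CQ T f) (n : ℕ) :
    CQ T (fun x t => f x t ^ n) := ContinuousOn.pow hf n
lemma CQ.sum2 {T : ℝ} {f : Fin 2 → ℝ → ℝ → ℝ} (hf : ∀ i, CQ T (f i)) :
    CQ T (fun x t => ∑ i, f i x t) := by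
  simp only [Fin.sum_univ_two]; exact (hf 0).add (hf 1)
lemma CQ.rpow {T : ℝ} {f : ℝ → ℝ → ℝ} (hf : CQ T f) (a : ℝ)
    (hp : ∀ x ∈ Icc (0:ℝ) 1, ∀ t ∈ Icc (0:ℝ) T, 0 < f x t) :
    CQ T (fun x t => f x t ^ a) :=
  ContinuousOn.rpow_const hf (fun p hh => Or.inl (hp p.1 hh.1 p.2 hh.2).ne')
lemma CQ.inv {T : ℝ} {f : ℝ → ℝ → ℝ} (hf : CQ T f)
    (hp : ∀ x ∈ Icc (0:ℝ) 1, ∀ t ∈ Icc (0:ℝ) T, 0 < f x t) :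
    CQ T (fun x t => (f x t)⁻¹) :=
  ContinuousOn.inv₀ hf (fun p hh => (hp p.1 hh.1 p.2 hh.2).ne')
lemma CQ.congr {T : ℝ} {f g : ℝ → ℝ → ℝ} (hf : CQ T f)
    (h : ∀ x ∈ Icc (0:ℝ) 1, ∀ t ∈ Icc (0:ℝ) T, g x t = f x t) : CQ T g :=
  ContinuousOn.congr hf (fun p hh => h p.1 hh.1 p.2 hh.2)

/-- Space-time balance law. -/
lemma balance {T : ℝ} (hT : 0 ≤ T) {f ft g gx h : ℝ → ℝ → ℝ}
    (hf : ∀ x ∈ Icc (0:ℝ) 1, ∀ t ∈ Icc (0:ℝ) T, HasDerivAt (fun s => f x s) (ft x t) t)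
    (hg : ∀ x ∈ Icc (0:ℝ) 1, ∀ t ∈ Icc (0:ℝ) T, HasDerivAt (fun y => g y t) (gx x t) x)
    (cf : CQ T f) (cft : CQ T ft) (cgx : CQ T gx)
    (he : ∀ x ∈ Icc (0:ℝ) 1, ∀ t ∈ Icc (0:ℝ) T, ft x t + gx x t = h x t)
    (hb : ∀ t ∈ Icc (0:ℝ) T, g 0 t = g 1 t) :
    II T h = (∫ x in (0:ℝ)..1, f x T) - ∫ x in (0:ℝ)..1, f x 0 := by
  have hT' : T ∈ Icc (0:ℝ) T := ⟨hT, le_rfl⟩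
  have h0' : (0:ℝ) ∈ Icc (0:ℝ) T := ⟨le_rfl, hT⟩
  rw [← II_congr hT he, II_add hT cft cgx]
  have e1 : II T gx = 0 := by
    unfold II
    have e0 : ∫ s in (0:ℝ)..T, (0:ℝ) = 0 := by simp
    refine Eq.trans (integral_congrT (g := fun _ => 0) hT ?_) e0
    intro t ht
    show ∫ y in (0:ℝ)..1, gx y t = 0
    rw [intervalIntegral.integral_eq_sub_of_hasDerivAt (f := fun y => g y t) _ (cgx.int ht)]
    · rw [hb t ht]; ring
    · intro x hx
      rw [uIcc_of_le zero_le_one] at hx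
      exact hg x hx t ht
  rw [e1, add_zero, cft.swap hT, ← intervalIntegral.integral_sub (cf.int hT') (cf.int h0')]
  apply integral_congr01
  intro x hx
  rw [intervalIntegral.integral_eq_sub_of_hasDerivAt (f := fun s => f x s) _ (cft.intt hT hx)]
  intro t ht
  rw [uIcc_of_le hT] at ht
  exact hf x hx t ht

/-! ### smooth fields -/

/-- globally smooth field -/
def Sm (f : ℝ → ℝ → ℝ) : Prop := ContDiff ℝ (⊤ : ℕ∞) (Function.uncurry f)

lemma Sm.cont {f : ℝ → ℝ → ℝ} (hf : Sm f) : Continuous (Function.uncurry f) :=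
  ContDiff.continuous hf

lemma Sm.cq {f : ℝ → ℝ → ℝ} (hf : Sm f) (T : ℝ) : CQ T f := hf.cont.continuousOn

lemma Sm.hasF {f : ℝ → ℝ → ℝ} (hf : Sm f) (p : ℝ × ℝ) :
    HasFDerivAt (Function.uncurry f) (fderiv ℝ (Function.uncurry f) p) p :=
  (ContDiff.differentiable hf (by simp) p).hasFDerivAt

lemma Sm.hx0 {f : ℝ → ℝ → ℝ} (hf : Sm f) (x t : ℝ) :
    HasDerivAt (fun y => f y t) (fderiv ℝ (Function.uncurry f) (x, t) (1, 0)) x := by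
  have h1 : HasDerivAt (fun y : ℝ => (y, t)) ((1:ℝ), (0:ℝ)) x :=
    (hasDerivAt_id x).prodMk (hasDerivAt_const x t)
  exact (hf.hasF (x, t)).comp_hasDerivAt x h1

lemma Sm.ht0 {f : ℝ → ℝ → ℝ} (hf : Sm f) (x t : ℝ) :
    HasDerivAt (fun s => f x s) (fderiv ℝ (Function.uncurry f) (x, t) (0, 1)) t := by
  have h1 : HasDerivAt (fun s : ℝ => (x, s)) ((0:ℝ), (1:ℝ)) t :=
    (hasDerivAt_const t x).prodMk (hasDerivAt_id t)
  exact (hf.hasF (x, t)).comp_hasDerivAt t h1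

lemma Sm.pdx_eq {f : ℝ → ℝ → ℝ} (hf : Sm f) (x t : ℝ) :
    pdx f x t = fderiv ℝ (Function.uncurry f) (x, t) (1, 0) := (hf.hx0 x t).deriv

lemma Sm.pdt_eq {f : ℝ → ℝ → ℝ} (hf : Sm f) (x t : ℝ) :
    pdt f x t = fderiv ℝ (Function.uncurry f) (x, t) (0, 1) := (hf.ht0 x t).deriv

lemma Sm.hx {f : ℝ → ℝ → ℝ} (hf : Sm f) (x t : ℝ) :
    HasDerivAt (fun y => f y t) (pdx f x t) x := by
  rw [hf.pdx_eq]; exact hf.hx0 x t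

lemma Sm.ht {f : ℝ → ℝ → ℝ} (hf : Sm f) (x t : ℝ) :
    HasDerivAt (fun s => f x s) (pdt f x t) t := by
  rw [hf.pdt_eq]; exact hf.ht0 x t

lemma Sm.pdx {f : ℝ → ℝ → ℝ} (hf : Sm f) : Sm (pdx f) := by
  have : Function.uncurry (_root_.pdx f) =
      fun p => fderiv ℝ (Function.uncurry f) p (1, 0) := by
    funext p; exact hf.pdx_eq p.1 p.2
  unfold Sm
  rw [this]
  exact (ContDiff.fderiv_right hf (m := ((⊤:ℕ∞) : WithTop ℕ∞)) (by simp)).clm_apply contDiff_const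

lemma Sm.pdt {f : ℝ → ℝ → ℝ} (hf : Sm f) : Sm (pdt f) := by
  have : Function.uncurry (_root_.pdt f) =
      fun p => fderiv ℝ (Function.uncurry f) p (0, 1) := by
    funext p; exact hf.pdt_eq p.1 p.2
  unfold Sm
  rw [this]
  exact (ContDiff.fderiv_right hf (m := ((⊤:ℕ∞) : WithTop ℕ∞)) (by simp)).clm_apply contDiff_const

lemma Sm.mul {f g : ℝ → ℝ → ℝ} (hf : Sm f) (hg : Sm g) : Sm (fun x t => f x t * g x t) :=
  ContDiff.mul hf hg

/-- differentiation under the integral sign for continuous derivative -/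
lemma deriv_under {f ft : ℝ → ℝ → ℝ} (cf : Continuous (Function.uncurry f))
    (cft : Continuous (Function.uncurry ft))
    (h : ∀ x t, HasDerivAt (fun s => f x s) (ft x t) t) (a b t : ℝ) :
    HasDerivAt (fun s => ∫ y in a..b, f y s) (∫ y in a..b, ft y t) t := by
  have key : ∀ s, ∫ y in a..b, f y s
      = (∫ y in a..b, f y 0) + ∫ r in (0:ℝ)..s, ∫ y in a..b, ft y r := by
    intro s
    rw [swap_cont cft]
    have c1 : ∀ s, Continuous (fun y => f y s) := fun s => by
      exact cf.comp (by fun_prop : Continuous fun y : ℝ => (y, s))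
    rw [← sub_eq_iff_eq_add', ← intervalIntegral.integral_sub
      ((c1 s).intervalIntegrable _ _) ((c1 0).intervalIntegrable _ _)]
    apply intervalIntegral.integral_congr
    intro y _
    symm
    apply intervalIntegral.integral_eq_sub_of_hasDerivAt (f := fun s => f y s)
    · intro r _; exact h y r
    · exact (cft.comp (by fun_prop : Continuous fun r : ℝ => (y, r))).intervalIntegrable _ _
  have c2 : Continuous (fun r => ∫ y in a..b, ft y r) := by
    apply intervalIntegral.continuous_parametric_intervalIntegral_of_continuous' (f := fun t x => ft x t)
    exact cft.comp continuous_swap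
  have : (fun s => ∫ y in a..b, f y s) =
    fun s => (∫ y in a..b, f y 0) + ∫ r in (0:ℝ)..s, ∫ y in a..b, ft y r := funext key
  rw [this]
  exact (intervalIntegral.integral_hasDerivAt_right (c2.intervalIntegrable _ _)
    (c2.stronglyMeasurableAtFilter _ _) c2.continuousAt).const_add _

/-! ### pointwise form of the equations -/

section pointwise
variable {T : ℝ} {κ : ℝ → ℝ} (sol : MHDSol T κ)

/-- dissipation -/
def Dis (x t : ℝ) : ℝ :=
  (pdx sol.u x t) ^ 2 + (∑ i, (pdx (sol.w i) x t) ^ 2) + (∑ i, (pdx (sol.b i) x t) ^ 2)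

lemma sρ : Sm sol.ρ := sol.smooth_ρ
lemma su : Sm sol.u := sol.smooth_u
lemma sθ : Sm sol.θ := sol.smooth_θ
lemma sw (i : Fin 2) : Sm (sol.w i) := sol.smooth_w i
lemma sb (i : Fin 2) : Sm (sol.b i) := sol.smooth_b i

lemma Dis_cq : CQ T (Dis sol) := by
  unfold Dis
  refine (((su sol).pdx.cq T).pow 2 |>.add ?_).add ?_
  · exact CQ.sum2 (fun i => ((sw sol i).pdx.cq T).pow 2)
  · exact CQ.sum2 (fun i => ((sb sol i).pdx.cq T).pow 2)

lemma mass_pt {x t : ℝ} (hx : x ∈ Icc (0:ℝ) 1) (ht : t ∈ Icc (0:ℝ) T) :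
    pdt sol.ρ x t + (pdx sol.ρ x t * sol.u x t + sol.ρ x t * pdx sol.u x t) = 0 := by
  have h := sol.eq_mass x hx t ht
  have h1 : pdx (fun x t => sol.ρ x t * sol.u x t) x t
    = pdx sol.ρ x t * sol.u x t + sol.ρ x t * pdx sol.u x t :=
    (((sρ sol).hx x t).mul ((su sol).hx x t)).deriv
  rw [h1] at h; exact h

lemma mom_pt {x t : ℝ} (hx : x ∈ Icc (0:ℝ) 1) (ht : t ∈ Icc (0:ℝ) T) :
    sol.ρ x t * pdt sol.u x t + sol.ρ x t * sol.u x t * pdx sol.u x t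
     + (pdx sol.ρ x t * sol.θ x t + sol.ρ x t * pdx sol.θ x t)
     + (sol.b 0 x t * pdx (sol.b 0) x t + sol.b 1 x t * pdx (sol.b 1) x t)
     = pdx (pdx sol.u) x t := by
  have h := sol.eq_mom x hx t ht
  have hm := mass_pt sol hx ht
  have h1 : pdt (fun x t => sol.ρ x t * sol.u x t) x t
    = pdt sol.ρ x t * sol.u x t + sol.ρ x t * pdt sol.u x t :=
    (((sρ sol).ht x t).mul ((su sol).ht x t)).deriv
  have h2 := ((((sρ sol).hx x t).mul (((su sol).hx x t).pow 2)).add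
    (((sρ sol).hx x t).mul ((sθ sol).hx x t))).add
    (((((sb sol 0).hx x t).pow 2).add (((sb sol 1).hx x t).pow 2)).div_const 2)
  have h3 : pdx (fun x t =>
          sol.ρ x t * (sol.u x t) ^ 2 + sol.ρ x t * sol.θ x t
            + ((sol.b 0 x t) ^ 2 + (sol.b 1 x t) ^ 2) / 2) x t = _ := h2.deriv
  simp only [Fin.sum_univ_two] at h
  rw [h1, h3] at h
  simp only [Pi.pow_apply, Pi.mul_apply] at h
  push_cast at h
  linear_combination h - sol.u x t * hm

lemma w_pt (i : Fin 2) {x t : ℝ} (hx : x ∈ Icc (0:ℝ) 1) (ht : t ∈ Icc (0:ℝ) T) :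
    sol.ρ x t * pdt (sol.w i) x t + sol.ρ x t * sol.u x t * pdx (sol.w i) x t
     - pdx (sol.b i) x t = pdx (pdx (sol.w i)) x t := by
  have h := sol.eq_w i x hx t ht
  have hm := mass_pt sol hx ht
  have h1 : pdt (fun x t => sol.ρ x t * sol.w i x t) x t
    = pdt sol.ρ x t * sol.w i x t + sol.ρ x t * pdt (sol.w i) x t :=
    (((sρ sol).ht x t).mul ((sw sol i).ht x t)).deriv
  have h2 := ((((sρ sol).hx x t).mul (((su sol).hx x t))).mul ((sw sol i).hx x t)).sub
    ((sb sol i).hx x t)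
  have h3 : pdx (fun x t => sol.ρ x t * sol.u x t * sol.w i x t - sol.b i x t) x t = _ := h2.deriv
  rw [h1, h3] at h
  simp only [Pi.mul_apply] at h
  linear_combination h - sol.w i x t * hm

lemma b_pt (i : Fin 2) {x t : ℝ} (hx : x ∈ Icc (0:ℝ) 1) (ht : t ∈ Icc (0:ℝ) T) :
    pdt (sol.b i) x t + pdx sol.u x t * sol.b i x t + sol.u x t * pdx (sol.b i) x t
     - pdx (sol.w i) x t = pdx (pdx (sol.b i)) x t := by
  have h := sol.eq_b i x hx t ht
  have h2 := (((su sol).hx x t).mul ((sb sol i).hx x t)).sub ((sw sol i).hx x t)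
  have h3 : pdx (fun x t => sol.u x t * sol.b i x t - sol.w i x t) x t = _ := h2.deriv
  rw [h3] at h
  linear_combination h

/-- the divergence of the heat flux -/
def Kx (x t : ℝ) : ℝ := pdx (fun x t => κ (sol.θ x t) * pdx sol.θ x t) x t

lemma θ_pt {x t : ℝ} (hx : x ∈ Icc (0:ℝ) 1) (ht : t ∈ Icc (0:ℝ) T) :
    sol.ρ x t * pdt sol.θ x t + sol.ρ x t * sol.u x t * pdx sol.θ x t
     - Kx sol x t = Dis sol x t - sol.ρ x t * sol.θ x t * pdx sol.u x t := by
  have h := sol.eq_θ x hx t ht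
  have hm := mass_pt sol hx ht
  have h1 : pdt (fun x t => sol.ρ x t * sol.θ x t) x t
    = pdt sol.ρ x t * sol.θ x t + sol.ρ x t * pdt sol.θ x t :=
    (((sρ sol).ht x t).mul ((sθ sol).ht x t)).deriv
  have h2 := ((((sρ sol).hx x t).mul (((su sol).hx x t))).mul ((sθ sol).hx x t))
  have h3 : pdx (fun x t => sol.ρ x t * sol.u x t * sol.θ x t) x t = _ := h2.deriv
  rw [h1, h3] at h
  simp only [Pi.mul_apply] at h
  unfold Kx Dis
  linear_combination h - sol.θ x t * hm

lemma Kx_cq : CQ T (Kx sol) := by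
  have h1 : CQ T (fun x t => sol.ρ x t * pdt sol.θ x t + sol.ρ x t * sol.u x t * pdx sol.θ x t
     - (Dis sol x t - sol.ρ x t * sol.θ x t * pdx sol.u x t)) :=
    ((((sρ sol).cq T).mul ((sθ sol).pdt.cq T)).add
      ((((sρ sol).cq T).mul ((su sol).cq T)).mul ((sθ sol).pdx.cq T))).sub
      ((Dis_cq sol).sub ((((sρ sol).cq T).mul ((sθ sol).cq T)).mul ((su sol).pdx.cq T)))
  refine h1.congr ?_
  intro x hx t ht
  linear_combination - (θ_pt sol hx ht)

lemma Kx_has {q C₀ : ℝ} (hκ : KappaHyp q C₀ κ) {x t : ℝ} (hx : x ∈ Icc (0:ℝ) 1)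
    (ht : t ∈ Icc (0:ℝ) T) :
    HasDerivAt (fun y => κ (sol.θ y t) * pdx sol.θ y t) (Kx sol x t) x := by
  have hθ := sol.θ_pos x hx t ht
  have h1 : DifferentiableAt ℝ κ (sol.θ x t) :=
    (hκ.1.contDiffAt (Ici_mem_nhds hθ)).differentiableAt (by norm_num)
  have h2 : DifferentiableAt ℝ (fun y => κ (sol.θ y t)) x :=
    DifferentiableAt.comp (g := κ) (f := fun y => sol.θ y t) x h1
      ((sθ sol).hx x t).differentiableAt
  exact (h2.mul ((sθ sol).pdx.hx x t).differentiableAt).hasDerivAt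

lemma κθ_cq {q C₀ : ℝ} (hκ : KappaHyp q C₀ κ) : CQ T (fun x t => κ (sol.θ x t)) := by
  apply ContinuousOn.comp (g := κ) (t := Ici 0) hκ.1.continuousOn ((sθ sol).cq T)
  intro p hp
  exact (sol.θ_pos p.1 hp.1 p.2 hp.2).le

/-! ### integral identities -/

lemma mass_int {S : ℝ} (hS : S ∈ Icc (0:ℝ) T) :
    ∫ x in (0:ℝ)..1, sol.ρ x S = ∫ x in (0:ℝ)..1, sol.ρ x 0 := by
  have hsub : ∀ t ∈ Icc (0:ℝ) S, t ∈ Icc (0:ℝ) T := fun t ht => ⟨ht.1, ht.2.trans hS.2⟩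
  have h := balance (T := S) hS.1 (f := sol.ρ) (ft := pdt sol.ρ)
    (g := fun x t => sol.ρ x t * sol.u x t)
    (gx := fun x t => pdx sol.ρ x t * sol.u x t + sol.ρ x t * pdx sol.u x t)
    (h := fun _ _ => 0) (fun x _ t _ => (sρ sol).ht x t)
    (fun x _ t _ => ((sρ sol).hx x t).mul ((su sol).hx x t))
    ((sρ sol).cq S) ((sρ sol).pdt.cq S)
    ((((sρ sol).pdx.cq S).mul ((su sol).cq S)).add (((sρ sol).cq S).mul ((su sol).pdx.cq S)))
    (fun x hx t ht => mass_pt sol hx (hsub t ht))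
    (fun t ht => by
      have := sol.bc_u t (hsub t ht)
      simp only [this.1, this.2, mul_zero])
  simp only [II, intervalIntegral.integral_zero] at h
  linarith

/-- kinetic + magnetic energy density -/
def Kin (x t : ℝ) : ℝ :=
  sol.ρ x t * sol.u x t ^ 2 / 2 + (sol.ρ x t * sol.w 0 x t ^ 2 / 2 + sol.ρ x t * sol.w 1 x t ^ 2 / 2)
    + (sol.b 0 x t ^ 2 / 2 + sol.b 1 x t ^ 2 / 2)

/-- its flux -/
def KinF (x t : ℝ) : ℝ :=
  sol.ρ x t * sol.u x t * (sol.u x t ^ 2 / 2 + (sol.w 0 x t ^ 2 / 2 + sol.w 1 x t ^ 2 / 2))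
  + sol.u x t * (sol.ρ x t * sol.θ x t + (sol.b 0 x t ^ 2 + sol.b 1 x t ^ 2))
  - (sol.w 0 x t * sol.b 0 x t + sol.w 1 x t * sol.b 1 x t)
  - sol.u x t * pdx sol.u x t
  - (sol.w 0 x t * pdx (sol.w 0) x t + sol.w 1 x t * pdx (sol.w 1) x t)
  - (sol.b 0 x t * pdx (sol.b 0) x t + sol.b 1 x t * pdx (sol.b 1) x t)

lemma Kin_sm : Sm (Kin sol) := by
  have h1 := sol.smooth_ρ
  have h2 := sol.smooth_u
  have h3 := sol.smooth_w 0
  have h4 := sol.smooth_w 1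
  have h5 := sol.smooth_b 0
  have h6 := sol.smooth_b 1
  unfold Sm Kin
  simp only [Function.uncurry_def] at *
  fun_prop

lemma KinF_sm : Sm (KinF sol) := by
  have h1 := sol.smooth_ρ
  have h2 := sol.smooth_u
  have h3 := sol.smooth_w 0
  have h4 := sol.smooth_w 1
  have h5 := sol.smooth_b 0
  have h6 := sol.smooth_b 1
  have h7 := sol.smooth_θ
  have h8 : ContDiff ℝ (⊤ : ℕ∞) (Function.uncurry (pdx sol.u)) := (su sol).pdx
  have h9 : ContDiff ℝ (⊤ : ℕ∞) (Function.uncurry (pdx (sol.w 0))) := (sw sol 0).pdx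
  have h10 : ContDiff ℝ (⊤ : ℕ∞) (Function.uncurry (pdx (sol.w 1))) := (sw sol 1).pdx
  have h11 : ContDiff ℝ (⊤ : ℕ∞) (Function.uncurry (pdx (sol.b 0))) := (sb sol 0).pdx
  have h12 : ContDiff ℝ (⊤ : ℕ∞) (Function.uncurry (pdx (sol.b 1))) := (sb sol 1).pdx
  unfold Sm KinF
  simp only [Function.uncurry_def] at *
  fun_prop

lemma Kin_pt {x t : ℝ} (hx : x ∈ Icc (0:ℝ) 1) (ht : t ∈ Icc (0:ℝ) T) :
    pdt (Kin sol) x t + pdx (KinF sol) x t =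
      sol.ρ x t * sol.θ x t * pdx sol.u x t - Dis sol x t := by
  have ρt := (sρ sol).ht x t
  have ut := (su sol).ht x t
  have wt := fun i => (sw sol i).ht x t
  have bt := fun i => (sb sol i).ht x t
  have ρx := (sρ sol).hx x t
  have ux := (su sol).hx x t
  have θx := (sθ sol).hx x t
  have wx := fun i => (sw sol i).hx x t
  have bx := fun i => (sb sol i).hx x t
  have uxx := (su sol).pdx.hx x t
  have wxx := fun i => (sw sol i).pdx.hx x t
  have bxx := fun i => (sb sol i).pdx.hx x t
  have e1 : pdt (Kin sol) x t = _ :=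
    ((((ρt.mul (ut.pow 2)).div_const 2).add
      (((ρt.mul ((wt 0).pow 2)).div_const 2).add ((ρt.mul ((wt 1).pow 2)).div_const 2))).add
      ((((bt 0).pow 2).div_const 2).add (((bt 1).pow 2).div_const 2))).deriv
  have e2 : pdx (KinF sol) x t = _ :=
    (((((((ρx.mul ux).mul (((ux.pow 2).div_const 2).add
        ((((wx 0).pow 2).div_const 2).add (((wx 1).pow 2).div_const 2)))).add
      (ux.mul ((ρx.mul θx).add (((bx 0).pow 2).add ((bx 1).pow 2))))).sub
      (((wx 0).mul (bx 0)).add ((wx 1).mul (bx 1)))).sub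
      (ux.mul uxx)).sub
      (((wx 0).mul (wxx 0)).add ((wx 1).mul (wxx 1)))).sub
      (((bx 0).mul (bxx 0)).add ((bx 1).mul (bxx 1)))).deriv
  rw [e1, e2]
  simp only [Pi.pow_apply, Pi.mul_apply, Pi.add_apply, Dis, Fin.sum_univ_two]
  push_cast
  have m := mass_pt sol hx ht
  have a := mom_pt sol hx ht
  have b0 := w_pt sol 0 hx ht
  have b1 := w_pt sol 1 hx ht
  have c0 := b_pt sol 0 hx ht
  have c1 := b_pt sol 1 hx ht
  linear_combination (sol.u x t ^ 2 / 2 + (sol.w 0 x t ^ 2 / 2 + sol.w 1 x t ^ 2 / 2)) * m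
    + sol.u x t * a + sol.w 0 x t * b0 + sol.w 1 x t * b1 + sol.b 0 x t * c0 + sol.b 1 x t * c1

lemma kin_int {S : ℝ} (hS : S ∈ Icc (0:ℝ) T) :
    II S (fun x t => sol.ρ x t * sol.θ x t * pdx sol.u x t - Dis sol x t)
      = (∫ x in (0:ℝ)..1, Kin sol x S) - ∫ x in (0:ℝ)..1, Kin sol x 0 := by
  have hsub : ∀ t ∈ Icc (0:ℝ) S, t ∈ Icc (0:ℝ) T := fun t ht => ⟨ht.1, ht.2.trans hS.2⟩
  refine balance (T := S) hS.1 (ft := pdt (Kin sol)) (g := KinF sol) (gx := pdx (KinF sol))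
    (fun x _ t _ => (Kin_sm sol).ht x t) (fun x _ t _ => (KinF_sm sol).hx x t)
    ((Kin_sm sol).cq S) ((Kin_sm sol).pdt.cq S) ((KinF_sm sol).pdx.cq S)
    (fun x hx t ht => Kin_pt sol hx (hsub t ht)) ?_
  intro t ht
  have := sol.bc_u t (hsub t ht)
  have hw := fun i => sol.bc_w i t (hsub t ht)
  have hb := fun i => sol.bc_b i t (hsub t ht)
  simp only [KinF, this.1, this.2, (hw 0).1, (hw 0).2, (hw 1).1, (hw 1).2, (hb 0).1, (hb 0).2,
    (hb 1).1, (hb 1).2]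
  ring

lemma heat_int {q C₀ : ℝ} (hκ : KappaHyp q C₀ κ) {S : ℝ} (hS : S ∈ Icc (0:ℝ) T) :
    II S (fun x t => Dis sol x t - sol.ρ x t * sol.θ x t * pdx sol.u x t)
      = (∫ x in (0:ℝ)..1, sol.ρ x S * sol.θ x S) - ∫ x in (0:ℝ)..1, sol.ρ x 0 * sol.θ x 0 := by
  have hsub : ∀ t ∈ Icc (0:ℝ) S, t ∈ Icc (0:ℝ) T := fun t ht => ⟨ht.1, ht.2.trans hS.2⟩
  have cρ := (sρ sol).cq S
  have cu := (su sol).cq S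
  have cθ := (sθ sol).cq S
  refine balance (T := S) hS.1
    (f := fun x t => sol.ρ x t * sol.θ x t)
    (ft := fun x t => pdt sol.ρ x t * sol.θ x t + sol.ρ x t * pdt sol.θ x t)
    (g := fun x t => sol.ρ x t * sol.u x t * sol.θ x t - κ (sol.θ x t) * pdx sol.θ x t)
    (gx := fun x t => (pdx sol.ρ x t * sol.u x t + sol.ρ x t * pdx sol.u x t) * sol.θ x t
       + sol.ρ x t * sol.u x t * pdx sol.θ x t - Kx sol x t)
    (fun x _ t _ => ((sρ sol).ht x t).mul ((sθ sol).ht x t))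
    (fun x hx t ht => ((((sρ sol).hx x t).mul ((su sol).hx x t)).mul ((sθ sol).hx x t)).sub
      (Kx_has sol hκ hx (hsub t ht)))
    (cρ.mul cθ)
    ((((sρ sol).pdt.cq S).mul cθ).add (cρ.mul ((sθ sol).pdt.cq S)))
    (((((((sρ sol).pdx.cq S).mul cu).add (cρ.mul ((su sol).pdx.cq S))).mul cθ).add
      ((cρ.mul cu).mul ((sθ sol).pdx.cq S))).sub ((Kx_cq sol).mono hS.2))
    (fun x hx t ht => ?_) ?_
  · have m := mass_pt sol hx (hsub t ht)
    have a := θ_pt sol hx (hsub t ht)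
    linear_combination sol.θ x t * m + a
  · intro t ht
    have h1 := sol.bc_u t (hsub t ht)
    have h2 := sol.bc_θ t (hsub t ht)
    simp only [h1.1, h1.2, h2.1, h2.2]
    ring

lemma wt_int {q C₀ : ℝ} (hκ : KappaHyp q C₀ κ) (hT : 0 ≤ T) {α : ℝ} (hα1 : α < 1) :
    II T (fun x t => α * κ (sol.θ x t) * pdx sol.θ x t ^ 2 * sol.θ x t ^ (-α - 1)
        + Dis sol x t * sol.θ x t ^ (-α) - sol.ρ x t * sol.θ x t ^ (1 - α) * pdx sol.u x t)
      = (∫ x in (0:ℝ)..1, sol.ρ x T * (sol.θ x T ^ (1 - α) / (1 - α)))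
        - ∫ x in (0:ℝ)..1, sol.ρ x 0 * (sol.θ x 0 ^ (1 - α) / (1 - α)) := by
  have cρ := (sρ sol).cq T
  have cu := (su sol).cq T
  have cθ := (sθ sol).cq T
  have ck := κθ_cq sol hκ
  have cp : ∀ a : ℝ, CQ T (fun x t => sol.θ x t ^ a) := fun a => cθ.rpow a sol.θ_pos
  have cd : CQ T (fun x t => sol.θ x t ^ (1 - α) / (1 - α)) := by
    simp only [div_eq_inv_mul]; exact (cp _).cmul _
  have hne : (1 - α) ≠ 0 := by linarith
  have pdert : ∀ x ∈ Icc (0:ℝ) 1, ∀ t ∈ Icc (0:ℝ) T,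
      HasDerivAt (fun s => sol.θ x s ^ (1 - α) / (1 - α)) (pdt sol.θ x t * sol.θ x t ^ (-α)) t := by
    intro x hx t ht
    have := (((sθ sol).ht x t).rpow_const (p := 1 - α)
      (Or.inl (sol.θ_pos x hx t ht).ne')).div_const (1 - α)
    refine this.congr_deriv ?_
    rw [show 1 - α - 1 = -α by ring]
    field_simp
  have pderx : ∀ x ∈ Icc (0:ℝ) 1, ∀ t ∈ Icc (0:ℝ) T,
      HasDerivAt (fun y => sol.θ y t ^ (1 - α) / (1 - α)) (pdx sol.θ x t * sol.θ x t ^ (-α)) x := by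
    intro x hx t ht
    have := (((sθ sol).hx x t).rpow_const (p := 1 - α)
      (Or.inl (sol.θ_pos x hx t ht).ne')).div_const (1 - α)
    refine this.congr_deriv ?_
    rw [show 1 - α - 1 = -α by ring]
    field_simp
  have pderx2 : ∀ x ∈ Icc (0:ℝ) 1, ∀ t ∈ Icc (0:ℝ) T,
      HasDerivAt (fun y => sol.θ y t ^ (-α)) (pdx sol.θ x t * (-α) * sol.θ x t ^ (-α - 1)) x := by
    intro x hx t ht
    exact (((sθ sol).hx x t).rpow_const (p := -α) (Or.inl (sol.θ_pos x hx t ht).ne'))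
  refine balance hT
    (f := fun x t => sol.ρ x t * (sol.θ x t ^ (1 - α) / (1 - α)))
    (ft := fun x t => pdt sol.ρ x t * (sol.θ x t ^ (1 - α) / (1 - α))
      + sol.ρ x t * (pdt sol.θ x t * sol.θ x t ^ (-α)))
    (g := fun x t => sol.ρ x t * sol.u x t * (sol.θ x t ^ (1 - α) / (1 - α))
      - κ (sol.θ x t) * pdx sol.θ x t * sol.θ x t ^ (-α))
    (gx := fun x t => (pdx sol.ρ x t * sol.u x t + sol.ρ x t * pdx sol.u x t)
         * (sol.θ x t ^ (1 - α) / (1 - α))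
       + sol.ρ x t * sol.u x t * (pdx sol.θ x t * sol.θ x t ^ (-α))
       - (Kx sol x t * sol.θ x t ^ (-α)
        + κ (sol.θ x t) * pdx sol.θ x t * (pdx sol.θ x t * (-α) * sol.θ x t ^ (-α - 1))))
    (fun x hx t ht => ((sρ sol).ht x t).mul (pdert x hx t ht))
    (fun x hx t ht => ((((sρ sol).hx x t).mul ((su sol).hx x t)).mul (pderx x hx t ht)).sub
      ((Kx_has sol hκ hx ht).mul (pderx2 x hx t ht)))
    (cρ.mul cd)
    ((((sρ sol).pdt.cq T).mul cd).add (cρ.mul (((sθ sol).pdt.cq T).mul (cp _))))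
    (((((((sρ sol).pdx.cq T).mul cu).add (cρ.mul ((su sol).pdx.cq T))).mul cd).add
      ((cρ.mul cu).mul (((sθ sol).pdx.cq T).mul (cp _)))).sub
      (((Kx_cq sol).mul (cp _)).add ((ck.mul ((sθ sol).pdx.cq T)).mul
        ((((sθ sol).pdx.cq T).mul (CQ.const _)).mul (cp _)))))
    (fun x hx t ht => ?_) ?_
  · have m := mass_pt sol hx ht
    have a := θ_pt sol hx ht
    have hθ := sol.θ_pos x hx t ht
    have e : sol.θ x t ^ (1 - α) = sol.θ x t * sol.θ x t ^ (-α) := by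
      rw [show 1 - α = 1 + -α by ring, Real.rpow_add hθ, Real.rpow_one]
    linear_combination (sol.θ x t ^ (1 - α) / (1 - α)) * m + sol.θ x t ^ (-α) * a
      + sol.ρ x t * pdx sol.u x t * e
  · intro t ht
    have h1 := sol.bc_u t ht
    have h2 := sol.bc_θ t ht
    simp only [h1.1, h1.2, h2.1, h2.2]
    ring

end pointwise

/-! ### energy and upper bound of the density -/

lemma maxp {T K F0 : ℝ} (hT : 0 ≤ T) {F Ft Fx u : ℝ → ℝ → ℝ} (hF : CQ T F)
    (h1 : ∀ x ∈ Icc (0:ℝ) 1, ∀ t ∈ Icc (0:ℝ) T, HasDerivAt (fun s => F x s) (Ft x t) t)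
    (h2 : ∀ x ∈ Icc (0:ℝ) 1, ∀ t ∈ Icc (0:ℝ) T, HasDerivAt (fun y => F y t) (Fx x t) x)
    (h3 : ∀ x ∈ Icc (0:ℝ) 1, ∀ t ∈ Icc (0:ℝ) T, Ft x t + u x t * Fx x t ≤ K)
    (hu : ∀ t ∈ Icc (0:ℝ) T, u 0 t = 0 ∧ u 1 t = 0)
    (h0 : ∀ x ∈ Icc (0:ℝ) 1, F x 0 ≤ F0) :
    ∀ x ∈ Icc (0:ℝ) 1, ∀ t ∈ Icc (0:ℝ) T, F x t ≤ F0 + K * t := by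
  have key : ∀ ε > 0, ∀ x ∈ Icc (0:ℝ) 1, ∀ t ∈ Icc (0:ℝ) T, F x t ≤ F0 + (K + ε) * t := by
    intro ε hε x hx t ht
    have hG : ContinuousOn (fun p : ℝ × ℝ => F p.1 p.2 - (K + ε) * p.2)
        (Icc (0:ℝ) 1 ×ˢ Icc (0:ℝ) T) :=
      ContinuousOn.sub hF (by fun_prop)
    obtain ⟨⟨a, s⟩, ⟨ha, hs⟩, hmax⟩ := (isCompact_Icc.prod isCompact_Icc).exists_isMaxOn
      ⟨(x, t), ⟨hx, ht⟩⟩ hG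
    simp only at ha hs
    have hm : ∀ y ∈ Icc (0:ℝ) 1, ∀ r ∈ Icc (0:ℝ) T,
        F y r - (K + ε) * r ≤ F a s - (K + ε) * s :=
      fun y hy r hr => hmax (a := (y, r)) ⟨hy, hr⟩
    have hs0 : s = 0 := by
      by_contra hne
      have hspos : 0 < s := lt_of_le_of_ne hs.1 (Ne.symm hne)
      -- time derivative is nonnegative
      have d1 : HasDerivAt (fun r => F a r - (K + ε) * r) (Ft a s - (K + ε) * 1) s :=
        (h1 a ha s hs).sub ((hasDerivAt_id s).const_mul (K + ε))
      have d2 := (hasDerivWithinAt_iff_tendsto_slope' (s := Iio s) (by simp)).1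
        d1.hasDerivWithinAt
      have hge : 0 ≤ Ft a s - (K + ε) * 1 := by
        refine ge_of_tendsto d2 ?_
        have : Ioo 0 s ∈ nhdsWithin s (Iio s) := Ioo_mem_nhdsLT hspos
        filter_upwards [this] with r hr
        rw [slope_def_field]
        have := hm a ha r ⟨hr.1.le, hr.2.le.trans hs.2⟩
        apply div_nonneg_of_nonpos
        · linarith
        · linarith [hr.2]
      have hux : u a s * Fx a s = 0 := by
        rcases eq_or_lt_of_le ha.1 with h | h
        · rw [← h, (hu s hs).1, zero_mul]
        rcases eq_or_lt_of_le ha.2 with h' | h'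
        · rw [h', (hu s hs).2, zero_mul]
        have : IsLocalMax (fun y => F y s) a := by
          filter_upwards [Ioo_mem_nhds h h'] with y hy
          have := hm y ⟨hy.1.le, hy.2.le⟩ s hs
          linarith
        rw [this.hasDerivAt_eq_zero (h2 a ha s hs), mul_zero]
      have := h3 a ha s hs
      linarith
    have e1 := hm x hx t ht
    have e2 := h0 a ha
    rw [hs0] at e1
    linarith
  intro x hx t ht
  apply le_of_forall_pos_le_add
  intro δ hδ
  have := key (δ / (T + 1)) (by positivity) x hx t ht
  have h5 : δ / (T + 1) * t ≤ δ := by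
    rw [div_mul_eq_mul_div, div_le_iff₀ (by positivity)]
    nlinarith [ht.2]
  linarith

section energy
variable {T : ℝ} {κ : ℝ → ℝ} (sol : MHDSol T κ)

lemma energy {q C₀ : ℝ} (hκ : KappaHyp q C₀ κ) {S : ℝ} (hS : S ∈ Icc (0:ℝ) T) :
    (∫ x in (0:ℝ)..1, Kin sol x S) + (∫ x in (0:ℝ)..1, sol.ρ x S * sol.θ x S)
    = (∫ x in (0:ℝ)..1, Kin sol x 0) + ∫ x in (0:ℝ)..1, sol.ρ x 0 * sol.θ x 0 := by
  have h1 := kin_int sol hS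
  have h2 := heat_int sol hκ hS
  have h3 : II S (fun x t => sol.ρ x t * sol.θ x t * pdx sol.u x t - Dis sol x t)
     = (-1) * II S (fun x t => Dis sol x t - sol.ρ x t * sol.θ x t * pdx sol.u x t) := by
    rw [← II_cmul]
    apply II_congr hS.1
    intro x _ t _; ring
  linarith

/-- initial total energy -/
def E0 : ℝ := (∫ x in (0:ℝ)..1, Kin sol x 0) + ∫ x in (0:ℝ)..1, sol.ρ x 0 * sol.θ x 0

lemma Kin_nonneg {x t : ℝ} (hx : x ∈ Icc (0:ℝ) 1) (ht : t ∈ Icc (0:ℝ) T) : 0 ≤ Kin sol x t := by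
  have := sol.ρ_pos x hx t ht
  unfold Kin; positivity

lemma ρθ_cq : CQ T (fun x t => sol.ρ x t * sol.θ x t) :=
  ((sρ sol).cq T).mul ((sθ sol).cq T)

lemma Kin_le {q C₀ E : ℝ} (hκ : KappaHyp q C₀ κ) (hE : E0 sol ≤ E) {S : ℝ}
    (hS : S ∈ Icc (0:ℝ) T) :
    ∫ x in (0:ℝ)..1, Kin sol x S ≤ E := by
  have h1 := energy sol hκ hS
  have h2 : 0 ≤ ∫ x in (0:ℝ)..1, sol.ρ x S * sol.θ x S := by
    apply intervalIntegral.integral_nonneg zero_le_one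
    intro x hx
    exact mul_nonneg (sol.ρ_pos x hx S hS).le (sol.θ_pos x hx S hS).le
  unfold E0 at hE
  linarith

lemma ρθ_le {q C₀ E : ℝ} (hκ : KappaHyp q C₀ κ) (hE : E0 sol ≤ E) {S : ℝ}
    (hS : S ∈ Icc (0:ℝ) T) :
    ∫ x in (0:ℝ)..1, sol.ρ x S * sol.θ x S ≤ E := by
  have h1 := energy sol hκ hS
  have h2 : 0 ≤ ∫ x in (0:ℝ)..1, Kin sol x S := by
    apply intervalIntegral.integral_nonneg zero_le_one
    intro x hx
    exact Kin_nonneg sol hx hS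
  unfold E0 at hE
  linarith

/-- total momentum flux -/
def Phi (x t : ℝ) : ℝ :=
  sol.ρ x t * sol.u x t ^ 2 + sol.ρ x t * sol.θ x t + (sol.b 0 x t ^ 2 + sol.b 1 x t ^ 2) / 2
    - pdx sol.u x t

/-- momentum -/
def Mo (x t : ℝ) : ℝ := sol.ρ x t * sol.u x t

lemma Mo_sm : Sm (Mo sol) := (sρ sol).mul (su sol)

lemma Phi_sm : Sm (Phi sol) := by
  have h1 := sol.smooth_ρ
  have h2 := sol.smooth_u
  have h5 := sol.smooth_b 0
  have h6 := sol.smooth_b 1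
  have h7 := sol.smooth_θ
  have h8 : ContDiff ℝ (⊤ : ℕ∞) (Function.uncurry (pdx sol.u)) := (su sol).pdx
  unfold Sm Phi
  simp only [Function.uncurry_def] at *
  fun_prop

lemma Mo_pt {x t : ℝ} (hx : x ∈ Icc (0:ℝ) 1) (ht : t ∈ Icc (0:ℝ) T) :
    pdt (Mo sol) x t = - pdx (Phi sol) x t := by
  have m := mass_pt sol hx ht
  have a := mom_pt sol hx ht
  have e1 : pdt (Mo sol) x t = _ := (((sρ sol).ht x t).mul ((su sol).ht x t)).deriv
  have e2 : pdx (Phi sol) x t = _ :=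
    (((((sρ sol).hx x t).mul (((su sol).hx x t).pow 2)).add
    (((sρ sol).hx x t).mul ((sθ sol).hx x t))).add
    (((((sb sol 0).hx x t).pow 2).add (((sb sol 1).hx x t).pow 2)).div_const 2)
    |>.sub ((su sol).pdx.hx x t)).deriv
  rw [e1, e2]
  simp only [Pi.pow_apply]
  push_cast
  linear_combination a + sol.u x t * m

/-- potential -/
def psi (x t : ℝ) : ℝ := ∫ y in (0:ℝ)..x, Mo sol y t

/-- mean of the potential -/
def mpsi (t : ℝ) : ℝ := ∫ y in (0:ℝ)..1, (1 - y) * Mo sol y t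

lemma psi_t {x t : ℝ} (hx : x ∈ Icc (0:ℝ) 1) (ht : t ∈ Icc (0:ℝ) T) :
    HasDerivAt (fun s => psi sol x s) (Phi sol 0 t - Phi sol x t) t := by
  have h := deriv_under (Mo_sm sol).cont (Mo_sm sol).pdt.cont (fun x t => (Mo_sm sol).ht x t) 0 x t
  refine h.congr_deriv ?_
  have hc : Continuous (fun y => pdx (Phi sol) y t) :=
    (Phi_sm sol).pdx.cont.comp (by fun_prop : Continuous fun y : ℝ => (y, t))
  have e1 : ∫ y in (0:ℝ)..x, pdt (Mo sol) y t = ∫ y in (0:ℝ)..x, - pdx (Phi sol) y t := by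
    apply intervalIntegral.integral_congr
    intro y hy
    rw [uIcc_of_le hx.1] at hy
    exact Mo_pt sol ⟨hy.1, hy.2.trans hx.2⟩ ht
  rw [e1, intervalIntegral.integral_neg,
    intervalIntegral.integral_eq_sub_of_hasDerivAt (f := fun y => Phi sol y t)
      (fun y _ => (Phi_sm sol).hx y t) (hc.intervalIntegrable _ _)]
  ring

lemma mpsi_t {t : ℝ} (ht : t ∈ Icc (0:ℝ) T) :
    HasDerivAt (fun s => mpsi sol s) (Phi sol 0 t - ∫ x in (0:ℝ)..1, Phi sol x t) t := by
  have c0 : Continuous (fun p : ℝ × ℝ => 1 - p.1) := by fun_prop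
  have h := deriv_under (f := fun y t => (1 - y) * Mo sol y t)
    (ft := fun y t => (1 - y) * pdt (Mo sol) y t)
    (c0.mul (Mo_sm sol).cont) (c0.mul (Mo_sm sol).pdt.cont)
    (fun x t => ((Mo_sm sol).ht x t).const_mul (1 - x)) 0 1 t
  refine h.congr_deriv ?_
  have hc : Continuous (fun y => pdx (Phi sol) y t) :=
    (Phi_sm sol).pdx.cont.comp (by fun_prop : Continuous fun y : ℝ => (y, t))
  have hc1 : Continuous (fun y => Phi sol y t) :=
    (Phi_sm sol).cont.comp (by fun_prop : Continuous fun y : ℝ => (y, t))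
  have hc2 : Continuous (fun y => Phi sol y t - (1 - y) * pdx (Phi sol) y t) :=
    hc1.sub ((by fun_prop : Continuous fun y : ℝ => 1 - y).mul hc)
  have e1 : ∫ y in (0:ℝ)..1, (1 - y) * pdt (Mo sol) y t
      = ∫ y in (0:ℝ)..1, ((Phi sol y t - (1 - y) * pdx (Phi sol) y t) - Phi sol y t) := by
    apply integral_congr01
    intro y hy
    rw [Mo_pt sol hy ht]; ring
  have hd : ∀ y : ℝ, HasDerivAt (fun y => (y - 1) * Phi sol y t)
      (Phi sol y t - (1 - y) * pdx (Phi sol) y t) y := by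
    intro y
    refine (((hasDerivAt_id y).sub_const 1).mul ((Phi_sm sol).hx y t)).congr_deriv ?_
    simp only [id]
    ring
  rw [e1, intervalIntegral.integral_sub (hc2.intervalIntegrable _ _) (hc1.intervalIntegrable _ _),
    intervalIntegral.integral_eq_sub_of_hasDerivAt (fun y _ => hd y) (hc2.intervalIntegrable _ _)]
  ring

lemma Phi_int {q C₀ E : ℝ} (hκ : KappaHyp q C₀ κ) (hE : E0 sol ≤ E) {t : ℝ}
    (ht : t ∈ Icc (0:ℝ) T) :
    ∫ x in (0:ℝ)..1, Phi sol x t ≤ 2 * E := by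
  have c1 := (Phi_sm sol).cq T
  have c2 := (su sol).pdx.cq T
  have c3 := (Kin_sm sol).cq T
  have c4 := ρθ_cq sol
  have e1 : ∫ x in (0:ℝ)..1, pdx sol.u x t = 0 := by
    rw [intervalIntegral.integral_eq_sub_of_hasDerivAt (f := fun y => sol.u y t)
      (fun y _ => (su sol).hx y t) (c2.int ht), (sol.bc_u t ht).1, (sol.bc_u t ht).2, sub_zero]
  have e2 : ∫ x in (0:ℝ)..1, Phi sol x t ≤
      ∫ x in (0:ℝ)..1, (2 * (Kin sol x t + sol.ρ x t * sol.θ x t) + (-1) * pdx sol.u x t) := by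
    apply intervalIntegral.integral_mono_on zero_le_one (c1.int ht)
      ((((c3.add c4).cmul 2).add (c2.cmul (-1))).int ht)
    intro x hx
    have hρ := sol.ρ_pos x hx t ht
    have hθ := sol.θ_pos x hx t ht
    have p1 : 0 ≤ sol.ρ x t * sol.θ x t := by positivity
    have p2 : 0 ≤ sol.ρ x t * sol.w 0 x t ^ 2 := by positivity
    have p3 : 0 ≤ sol.ρ x t * sol.w 1 x t ^ 2 := by positivity
    have p4 : 0 ≤ sol.b 0 x t ^ 2 := by positivity
    have p5 : 0 ≤ sol.b 1 x t ^ 2 := by positivity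
    unfold Phi Kin
    linarith
  rw [intervalIntegral.integral_add (((c3.add c4).cmul 2).int ht) ((c2.cmul (-1)).int ht),
    intervalIntegral.integral_const_mul, intervalIntegral.integral_const_mul,
    intervalIntegral.integral_add (c3.int ht) (c4.int ht), e1] at e2
  have := energy sol hκ ht
  unfold E0 at hE
  linarith

lemma Mo_abs {q C₀ E N0 : ℝ} (hκ : KappaHyp q C₀ κ) (hE : E0 sol ≤ E)
    (hN : ∫ x in (0:ℝ)..1, sol.ρ x 0 ≤ N0) {t : ℝ} (ht : t ∈ Icc (0:ℝ) T) :
    ∫ x in (0:ℝ)..1, |Mo sol x t| ≤ N0 / 2 + E := by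
  have c1 := (Mo_sm sol).cq T
  have c0 : CQ T (fun x t => |Mo sol x t|) := ContinuousOn.abs c1
  have c3 := (Kin_sm sol).cq T
  have c4 := (sρ sol).cq T
  have e2 : ∫ x in (0:ℝ)..1, |Mo sol x t| ≤
      ∫ x in (0:ℝ)..1, ((1/2) * sol.ρ x t + Kin sol x t) := by
    apply intervalIntegral.integral_mono_on zero_le_one (c0.int ht)
      (((c4.cmul (1/2)).add c3).int ht)
    intro x hx
    have hρ := sol.ρ_pos x hx t ht
    have p2 : 0 ≤ sol.ρ x t * sol.w 0 x t ^ 2 := by positivity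
    have p3 : 0 ≤ sol.ρ x t * sol.w 1 x t ^ 2 := by positivity
    have p4 : 0 ≤ sol.b 0 x t ^ 2 := by positivity
    have p5 : 0 ≤ sol.b 1 x t ^ 2 := by positivity
    unfold Mo Kin
    rw [abs_mul, abs_of_pos hρ]
    have h7 : 0 ≤ sol.ρ x t * (1 - |sol.u x t|) ^ 2 := by positivity
    have h8 : |sol.u x t| ^ 2 = sol.u x t ^ 2 := sq_abs _
    nlinarith
  rw [intervalIntegral.integral_add ((c4.cmul (1/2)).int ht) (c3.int ht),
    intervalIntegral.integral_const_mul, mass_int sol ht] at e2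
  have := Kin_le sol hκ hE ht
  linarith

lemma psi_abs {x t : ℝ} (hx : x ∈ Icc (0:ℝ) 1) :
    |psi sol x t| ≤ ∫ x in (0:ℝ)..1, |Mo sol x t| := by
  have hc : Continuous (fun y => |Mo sol y t|) :=
    ((Mo_sm sol).cont.comp (by fun_prop : Continuous fun y : ℝ => (y, t))).abs
  unfold psi
  refine (intervalIntegral.abs_integral_le_integral_abs hx.1).trans ?_
  apply intervalIntegral.integral_mono_interval le_rfl hx.1 hx.2 _ (hc.intervalIntegrable _ _)
  exact Filter.Eventually.of_forall (fun y => abs_nonneg _)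

lemma mpsi_abs {t : ℝ} :
    |mpsi sol t| ≤ ∫ x in (0:ℝ)..1, |Mo sol x t| := by
  have hc1 : Continuous (fun y => Mo sol y t) :=
    ((Mo_sm sol).cont.comp (by fun_prop : Continuous fun y : ℝ => (y, t)))
  have hc2 : Continuous (fun y => (1 - y) * Mo sol y t) :=
    (by fun_prop : Continuous fun y : ℝ => 1 - y).mul hc1
  unfold mpsi
  refine (intervalIntegral.abs_integral_le_integral_abs zero_le_one).trans ?_
  apply intervalIntegral.integral_mono_on zero_le_one (hc2.abs.intervalIntegrable _ _)
    (hc1.abs.intervalIntegrable _ _)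
  intro x hx
  rw [abs_mul]
  apply mul_le_of_le_one_left (abs_nonneg _)
  rw [abs_le]; constructor <;> linarith [hx.1, hx.2]

lemma ρ_bound {q C₀ E N0 R0 : ℝ} (hT : 0 ≤ T) (hκ : KappaHyp q C₀ κ) (hE : E0 sol ≤ E)
    (hN : ∫ x in (0:ℝ)..1, sol.ρ x 0 ≤ N0)
    (hR : ∀ x ∈ Icc (0:ℝ) 1, sol.ρ x 0 ≤ R0) (hE0 : 0 ≤ E) :
    ∀ x ∈ Icc (0:ℝ) 1, ∀ t ∈ Icc (0:ℝ) T,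
      sol.ρ x t ≤ R0 * Real.exp (4 * (N0 / 2 + E) + 2 * E * T) := by
  have h0T : (0:ℝ) ∈ Icc (0:ℝ) T := ⟨le_rfl, hT⟩
  have hR0 : 0 < R0 := (sol.ρ_pos 0 (by simp) 0 h0T).trans_le (hR 0 (by simp))
  have cpsi : Continuous (Function.uncurry (psi sol)) := by
    have := intervalIntegral.continuous_parametric_intervalIntegral_of_continuous
      (f := fun (p : ℝ × ℝ) y => Mo sol y p.2) (a₀ := 0) (μ := volume)
      ((Mo_sm sol).cont.comp
        (by fun_prop : Continuous fun z : (ℝ × ℝ) × ℝ => (z.2, z.1.2))) continuous_fst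
    exact this
  have cm : Continuous (mpsi sol) := by
    apply intervalIntegral.continuous_parametric_intervalIntegral_of_continuous'
      (f := fun t y => (1 - y) * Mo sol y t)
    exact (by fun_prop : Continuous fun z : ℝ × ℝ => 1 - z.2).mul
      ((Mo_sm sol).cont.comp continuous_swap)
  have clog : CQ T (fun x t => Real.log (sol.ρ x t)) :=
    ContinuousOn.log ((sρ sol).cq T) (fun p hp => (sol.ρ_pos p.1 hp.1 p.2 hp.2).ne')
  have cF : CQ T (fun x t => Real.log (sol.ρ x t) + psi sol x t - mpsi sol t) :=
    (clog.add cpsi.continuousOn).sub ((cm.comp continuous_snd).continuousOn)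
  have hab : ∀ x ∈ Icc (0:ℝ) 1, ∀ t ∈ Icc (0:ℝ) T,
      |psi sol x t - mpsi sol t| ≤ 2 * (N0 / 2 + E) := by
    intro x hx t ht
    have h1 := psi_abs sol (t := t) hx
    have h2 := mpsi_abs sol (t := t)
    have h3 := Mo_abs sol hκ hE hN ht
    have h4 := abs_sub (psi sol x t) (mpsi sol t)
    linarith
  have hmain := maxp (K := 2 * E) (F0 := Real.log R0 + 2 * (N0 / 2 + E)) hT cF (u := sol.u)
    (Ft := fun x t => pdt sol.ρ x t / sol.ρ x t + (Phi sol 0 t - Phi sol x t)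
      - (Phi sol 0 t - ∫ x in (0:ℝ)..1, Phi sol x t))
    (Fx := fun x t => pdx sol.ρ x t / sol.ρ x t + Mo sol x t)
    (fun x hx t ht => ((((sρ sol).ht x t).log (sol.ρ_pos x hx t ht).ne').add
      (psi_t sol hx ht)).sub (mpsi_t sol ht))
    (fun x hx t ht => by
      have hc : Continuous (fun y => Mo sol y t) :=
        (Mo_sm sol).cont.comp (by fun_prop : Continuous fun y : ℝ => (y, t))
      have h1 : HasDerivAt (fun y => psi sol y t) (Mo sol x t) x :=
        intervalIntegral.integral_hasDerivAt_right (hc.intervalIntegrable _ _)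
          (hc.stronglyMeasurableAtFilter _ _) hc.continuousAt
      exact ((((sρ sol).hx x t).log (sol.ρ_pos x hx t ht).ne').add h1).sub_const _)
    (fun x hx t ht => by
      have m := mass_pt sol hx ht
      have hρ := sol.ρ_pos x hx t ht
      have hθ := sol.θ_pos x hx t ht
      have hΦ := Phi_int sol hκ hE ht
      have e1 : pdt sol.ρ x t / sol.ρ x t + sol.u x t * (pdx sol.ρ x t / sol.ρ x t)
          = - pdx sol.u x t := by
        field_simp
        linear_combination m
      have p1 : 0 ≤ sol.ρ x t * sol.θ x t := by positivity
      have p4 : 0 ≤ sol.b 0 x t ^ 2 := by positivity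
      have p5 : 0 ≤ sol.b 1 x t ^ 2 := by positivity
      have e2 : sol.u x t * Mo sol x t = sol.ρ x t * sol.u x t ^ 2 := by unfold Mo; ring
      have e3 : Phi sol x t = sol.ρ x t * sol.u x t ^ 2 + sol.ρ x t * sol.θ x t
        + (sol.b 0 x t ^ 2 + sol.b 1 x t ^ 2) / 2 - pdx sol.u x t := rfl
      linarith)
    sol.bc_u
    (fun x hx => by
      have h1 := (abs_le.1 (hab x hx 0 h0T)).2
      have h2 := Real.log_le_log (sol.ρ_pos x hx 0 h0T) (hR x hx)
      linarith)
  intro x hx t ht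
  have h1 := hmain x hx t ht
  have h2 := (abs_le.1 (hab x hx t ht)).1
  have hρ := sol.ρ_pos x hx t ht
  have h3 : Real.log (sol.ρ x t) ≤ Real.log R0 + (4 * (N0 / 2 + E) + 2 * E * T) := by
    have : 2 * E * t ≤ 2 * E * T := mul_le_mul_of_nonneg_left ht.2 (by linarith)
    linarith
  calc sol.ρ x t = Real.exp (Real.log (sol.ρ x t)) := (Real.exp_log hρ).symm
    _ ≤ Real.exp (Real.log R0 + (4 * (N0 / 2 + E) + 2 * E * T)) := Real.exp_le_exp.2 h3
    _ = _ := by rw [Real.exp_add, Real.exp_log hR0]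

end energy

/-! ### temperature bounds and the main estimate -/

lemma osc {f f' : ℝ → ℝ} (hd : ∀ x ∈ Icc (0:ℝ) 1, HasDerivAt f (f' x) x)
    (hc : ContinuousOn f' (Icc 0 1)) {x y : ℝ} (hx : x ∈ Icc (0:ℝ) 1) (hy : y ∈ Icc (0:ℝ) 1) :
    f x ≤ f y + ∫ z in (0:ℝ)..1, |f' z| := by
  have hsub : uIcc y x ⊆ Icc (0:ℝ) 1 := by
    rw [← uIcc_of_le (zero_le_one (α := ℝ))] at *
    exact uIcc_subset_uIcc hy hx
  have e : ∫ z in y..x, f' z = f x - f y :=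
    intervalIntegral.integral_eq_sub_of_hasDerivAt (fun z hz => hd z (hsub hz))
      ((hc.mono hsub).intervalIntegrable)
  have h1 : |∫ z in y..x, f' z| ≤ |(∫ z in y..x, |f' z|)| := by
    have h := intervalIntegral.norm_integral_le_abs_integral_norm (f := f') (a := y) (b := x)
      (μ := MeasureTheory.volume)
    simpa only [Real.norm_eq_abs] using h
  have h2 : |(∫ z in y..x, |f' z|)| ≤ |(∫ z in (0:ℝ)..1, |f' z|)| := by
    apply intervalIntegral.abs_integral_mono_interval
    · apply Set.uIoc_subset_uIoc_of_uIcc_subset_uIcc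
      apply Set.uIcc_subset_uIcc <;> rwa [Set.uIcc_of_le zero_le_one]
    · exact Filter.Eventually.of_forall (fun y => abs_nonneg _)
    · exact hc.abs.intervalIntegrable_of_Icc zero_le_one
  have h3 : 0 ≤ ∫ z in (0:ℝ)..1, |f' z| :=
    intervalIntegral.integral_nonneg zero_le_one (fun _ _ => abs_nonneg _)
  rw [abs_of_nonneg h3] at h2
  have := le_abs_self (∫ z in y..x, f' z)
  linarith

lemma cs01 {a : ℝ → ℝ} (hc : ContinuousOn a (Icc 0 1)) :
    (∫ z in (0:ℝ)..1, a z) ^ 2 ≤ ∫ z in (0:ℝ)..1, a z ^ 2 := by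
  set I := ∫ z in (0:ℝ)..1, a z with hI
  have i1 : IntervalIntegrable a volume 0 1 := hc.intervalIntegrable_of_Icc zero_le_one
  have i2 : IntervalIntegrable (fun z => a z ^ 2) volume 0 1 :=
    (hc.pow 2).intervalIntegrable_of_Icc zero_le_one
  have h0 : 0 ≤ ∫ z in (0:ℝ)..1, (a z - I) ^ 2 :=
    intervalIntegral.integral_nonneg zero_le_one (fun _ _ => sq_nonneg _)
  have e : ∫ z in (0:ℝ)..1, (a z - I) ^ 2
      = ∫ z in (0:ℝ)..1, ((a z ^ 2 - (2 * I) * a z) + I ^ 2) := by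
    apply integral_congr01; intro x _; ring
  rw [e, intervalIntegral.integral_add (i2.sub (i1.const_mul _)) (by simp),
    intervalIntegral.integral_sub i2 (i1.const_mul _), intervalIntegral.integral_const_mul,
    ← hI] at h0
  simp only [intervalIntegral.integral_const, sub_zero, smul_eq_mul, one_mul] at h0
  linarith

lemma exists_le_mean {f : ℝ → ℝ} (hc : ContinuousOn f (Icc 0 1)) :
    ∃ y ∈ Icc (0:ℝ) 1, f y ≤ ∫ z in (0:ℝ)..1, f z := by
  by_contra! hcon
  set I := ∫ z in (0:ℝ)..1, f z with hI
  have : ∫ z in (0:ℝ)..1, I < ∫ z in (0:ℝ)..1, f z := by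
    apply intervalIntegral.integral_lt_integral_of_continuousOn_of_le_of_exists_lt zero_lt_one
      continuousOn_const hc
    · intro x hx; exact (hcon x ⟨hx.1.le, hx.2⟩).le
    · exact ⟨0, by simp, hcon 0 (by simp)⟩
  simp at this
  linarith

lemma H2_sup {f : ℝ → ℝ} {A : ℝ} (hf : ContDiff ℝ (⊤ : ℕ∞) f) (hA : H2norm f ≤ A) :
    ∀ x ∈ Icc (0:ℝ) 1, f x ^ 2 ≤ 2 * A ^ 2 := by
  have hf1 : ContDiff ℝ (⊤ : ℕ∞) (deriv f) := ((contDiff_infty_iff_deriv).1 hf).2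
  have hf2 : ContDiff ℝ (⊤ : ℕ∞) (deriv (deriv f)) := ((contDiff_infty_iff_deriv).1 hf1).2
  have c0 := hf.continuous
  have c1 := hf1.continuous
  have c2 := hf2.continuous
  have hd : ∀ x, HasDerivAt f (deriv f x) x :=
    fun x => (hf.differentiable (by simp) x).hasDerivAt
  have hnn : 0 ≤ ∫ x in (0:ℝ)..1, (f x) ^ 2 + (deriv f x) ^ 2 + (deriv (deriv f) x) ^ 2 :=
    intervalIntegral.integral_nonneg zero_le_one (fun _ _ => by positivity)
  have hI : ∫ x in (0:ℝ)..1, (f x) ^ 2 + (deriv f x) ^ 2 + (deriv (deriv f) x) ^ 2 ≤ A ^ 2 := by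
    have h := Real.sq_sqrt hnn
    rw [← h]
    exact pow_le_pow_left₀ (Real.sqrt_nonneg _) hA 2
  obtain ⟨y, hy, hy2⟩ := exists_le_mean (f := fun z => f z ^ 2) (by fun_prop)
  have i3 : IntervalIntegrable
      (fun x => (f x) ^ 2 + (deriv f x) ^ 2 + (deriv (deriv f) x) ^ 2) volume 0 1 :=
    Continuous.intervalIntegrable (by fun_prop) _ _
  have h1 : ∫ z in (0:ℝ)..1, f z ^ 2 ≤ A ^ 2 := by
    refine le_trans ?_ hI
    apply intervalIntegral.integral_mono_on zero_le_one
      (Continuous.intervalIntegrable (by fun_prop) _ _) i3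
    intro x _
    nlinarith [sq_nonneg (deriv f x), sq_nonneg (deriv (deriv f) x)]
  have h2 : ∫ z in (0:ℝ)..1, |2 * f z * deriv f z| ≤ A ^ 2 := by
    refine le_trans ?_ hI
    apply intervalIntegral.integral_mono_on zero_le_one
      (Continuous.intervalIntegrable (by fun_prop) _ _) i3
    intro x _
    rw [abs_le]
    constructor <;>
    nlinarith [sq_nonneg (deriv f x - f x), sq_nonneg (deriv f x + f x),
      sq_nonneg (deriv (deriv f) x)]
  intro x hx
  have := osc (f := fun z => f z ^ 2) (f' := fun z => 2 * f z * deriv f z)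
    (fun z _ => ((hd z).pow 2).congr_deriv (by push_cast; ring)) (by fun_prop) hx hy
  linarith

lemma rpow_young {α ε : ℝ} (hα : 0 < α) (hα1 : α < 1) (hε : 0 < ε) :
    ∃ Cε : ℝ, 0 ≤ Cε ∧ ∀ s : ℝ, 0 < s → s ^ (1 - α) ≤ ε * s + Cε := by
  refine ⟨((1 / ε) ^ (1 / α)) ^ (1 - α), by positivity, ?_⟩
  intro s hs
  have hs0 : 0 < (1 / ε) ^ (1 / α) := by positivity
  rcases le_total ((1 / ε) ^ (1 / α)) s with h | h
  · have h1 : 1 / ε ≤ s ^ α := by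
      have := Real.rpow_le_rpow hs0.le h hα.le
      rwa [← Real.rpow_mul (by positivity), one_div_mul_cancel hα.ne', Real.rpow_one] at this
    have h2 : s ^ (-α) ≤ ε := by
      rw [Real.rpow_neg hs.le]
      calc (s ^ α)⁻¹ ≤ (1 / ε)⁻¹ := inv_anti₀ (by positivity) h1
        _ = ε := by simp
    have h3 : s ^ (1 - α) = s * s ^ (-α) := by
      rw [show 1 - α = 1 + -α by ring, Real.rpow_add hs, Real.rpow_one]
    have h4 : 0 ≤ ((1 / ε) ^ (1 / α)) ^ (1 - α) := by positivity
    rw [h3]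
    nlinarith
  · have h1 := Real.rpow_le_rpow hs.le h (by linarith : 0 ≤ 1 - α)
    have : 0 ≤ ε * s := by positivity
    linarith

lemma rpow_le_one_add {s a q : ℝ} (hs : 0 < s) (ha : 0 ≤ a) (haq : a ≤ q) :
    s ^ a ≤ 1 + s ^ q := by
  rcases le_total s 1 with h | h
  · have := Real.rpow_le_one hs.le h ha
    have h2 : 0 ≤ s ^ q := by positivity
    linarith
  · have := Real.rpow_le_rpow_of_exponent_le h haq
    linarith

section temp
variable {T : ℝ} {κ : ℝ → ℝ} (sol : MHDSol T κ)

/-- weighted temperature gradient -/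
def jd (x t : ℝ) : ℝ := pdx sol.θ x t ^ 2 * (sol.θ x t)⁻¹

/-- its spatial integral -/
def J (t : ℝ) : ℝ := ∫ x in (0:ℝ)..1, jd sol x t

lemma jd_cq : CQ T (jd sol) :=
  (((sθ sol).pdx.cq T).pow 2).mul (((sθ sol).cq T).inv sol.θ_pos)

lemma J_int (hT : 0 ≤ T) : IntervalIntegrable (J sol) volume 0 T := (jd_cq sol).innerI hT

lemma θ_sup {q C₀ E M : ℝ} (hκ : KappaHyp q C₀ κ) (hE : E0 sol ≤ E) (hEp : 0 ≤ E) (hM : 0 < M)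
    (hm : M ≤ ∫ x in (0:ℝ)..1, sol.ρ x 0) {x t : ℝ} (hx : x ∈ Icc (0:ℝ) 1)
    (ht : t ∈ Icc (0:ℝ) T) :
    sol.θ x t ≤ 2 * (E / M) + J sol t / 2 := by
  have hex : ∃ y ∈ Icc (0:ℝ) 1, sol.θ y t ≤ E / M := by
    by_contra! hcon
    have cρ := ((sρ sol).cq T).cmul (E / M)
    have : ∫ z in (0:ℝ)..1, E / M * sol.ρ z t < ∫ z in (0:ℝ)..1, sol.ρ z t * sol.θ z t := by
      apply intervalIntegral.integral_lt_integral_of_continuousOn_of_le_of_exists_lt zero_lt_one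
        (cρ.x ht) ((ρθ_cq sol).x ht)
      · intro z hz
        have h1 := hcon z ⟨hz.1.le, hz.2⟩
        have h2 := sol.ρ_pos z ⟨hz.1.le, hz.2⟩ t ht
        nlinarith
      · refine ⟨0, by simp, ?_⟩
        have h1 := hcon 0 (by simp)
        have h2 := sol.ρ_pos 0 (by simp) t ht
        nlinarith
    rw [intervalIntegral.integral_const_mul, mass_int sol ht] at this
    have h1 := ρθ_le sol hκ hE ht
    have h2 : E / M * M ≤ E / M * ∫ x in (0:ℝ)..1, sol.ρ x 0 :=
      mul_le_mul_of_nonneg_left hm (by positivity)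
    rw [div_mul_cancel₀ _ hM.ne'] at h2
    linarith
  obtain ⟨y, hy, hyle⟩ := hex
  have cs : ContinuousOn (fun z => Real.sqrt (sol.θ z t)) (Icc 0 1) :=
    Real.continuous_sqrt.comp_continuousOn (((sθ sol).cq T).x ht)
  have cs' : ContinuousOn (fun z => pdx sol.θ z t / (2 * Real.sqrt (sol.θ z t))) (Icc 0 1) := by
    apply ContinuousOn.div (((sθ sol).pdx.cq T).x ht) (continuousOn_const.mul cs)
    intro z hz
    have := Real.sqrt_pos.2 (sol.θ_pos z hz t ht)
    exact (mul_pos two_pos this).ne'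
  have h1 := osc (f := fun z => Real.sqrt (sol.θ z t))
    (fun z hz => ((sθ sol).hx z t).sqrt (sol.θ_pos z hz t ht).ne') cs' hx hy
  have h2 := cs01 cs'.abs
  have h3 : ∫ z in (0:ℝ)..1, |pdx sol.θ z t / (2 * Real.sqrt (sol.θ z t))| ^ 2
      = (1/4) * J sol t := by
    unfold J
    rw [← intervalIntegral.integral_const_mul]
    apply integral_congr01
    intro z hz
    have hp := sol.θ_pos z hz t ht
    simp only [jd]
    rw [sq_abs, div_pow, mul_pow, Real.sq_sqrt hp.le]
    field_simp
    norm_num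
  rw [h3] at h2
  have e1 := Real.sq_sqrt (sol.θ_pos x hx t ht).le
  have e2 := Real.sq_sqrt (sol.θ_pos y hy t ht).le
  have n1 := Real.sqrt_nonneg (sol.θ x t)
  have n2 := Real.sqrt_nonneg (sol.θ y t)
  set I := ∫ z in (0:ℝ)..1, |pdx sol.θ z t / (2 * Real.sqrt (sol.θ z t))|
  set a := Real.sqrt (sol.θ x t)
  set c := Real.sqrt (sol.θ y t)
  nlinarith [sq_nonneg (c - I)]

lemma Dis_ge (x t : ℝ) : pdx sol.u x t ^ 2 ≤ Dis sol x t := by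
  unfold Dis
  simp only [Fin.sum_univ_two]
  nlinarith [sq_nonneg (pdx (sol.w 0) x t), sq_nonneg (pdx (sol.w 1) x t),
    sq_nonneg (pdx (sol.b 0) x t), sq_nonneg (pdx (sol.b 1) x t)]

lemma J_bound {q C₀ E M N0 R α ε Cε : ℝ} (hT : 0 ≤ T) (hC₀ : 1 ≤ C₀) (hκ : KappaHyp q C₀ κ)
    (hE : E0 sol ≤ E) (hEp : 0 ≤ E) (hM : 0 < M)
    (hm : M ≤ ∫ x in (0:ℝ)..1, sol.ρ x 0) (hN : ∫ x in (0:ℝ)..1, sol.ρ x 0 ≤ N0)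
    (hRp : 0 ≤ R) (hR : ∀ x ∈ Icc (0:ℝ) 1, ∀ t ∈ Icc (0:ℝ) T, sol.ρ x t ≤ R)
    (hα : 0 < α) (hα1 : α ≤ 1 / 2) (hαq : α ≤ q) (hε : 0 < ε) (hCε : 0 ≤ Cε)
    (hY : ∀ s : ℝ, 0 < s → s ^ (1 - α) ≤ ε * s + Cε)
    (hεR : R * E * ε / 8 ≤ α / C₀ / 2) :
    α / C₀ / 2 * (∫ t in (0:ℝ)..T, J sol t)
      ≤ 2 * (N0 + E) + R * E / 4 * (2 * ε * (E / M) + Cε) * T := by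
  have hTT : T ∈ Icc (0:ℝ) T := ⟨hT, le_rfl⟩
  have h0T : (0:ℝ) ∈ Icc (0:ℝ) T := ⟨le_rfl, hT⟩
  have hC0 : 0 < C₀ := by linarith
  have hw := wt_int sol hκ hT (α := α) (by linarith)
  have cρ := (sρ sol).cq T
  have cθ := (sθ sol).cq T
  have cρθ := ρθ_cq sol
  have cp : ∀ a : ℝ, CQ T (fun x t => sol.θ x t ^ a) := fun a => cθ.rpow a sol.θ_pos
  -- right-hand side
  have r0 : 0 ≤ ∫ x in (0:ℝ)..1, sol.ρ x 0 * (sol.θ x 0 ^ (1 - α) / (1 - α)) := by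
    apply intervalIntegral.integral_nonneg zero_le_one
    intro x hx
    have h1 := sol.ρ_pos x hx 0 h0T
    have h2 := sol.θ_pos x hx 0 h0T
    have h3 : 0 < 1 - α := by linarith
    positivity
  have r1 : ∫ x in (0:ℝ)..1, sol.ρ x T * (sol.θ x T ^ (1 - α) / (1 - α)) ≤ 2 * (N0 + E) := by
    have cd : CQ T (fun x t => sol.θ x t ^ (1 - α) / (1 - α)) := by
      simp only [div_eq_inv_mul]; exact (cp _).cmul _
    have : ∫ x in (0:ℝ)..1, sol.ρ x T * (sol.θ x T ^ (1 - α) / (1 - α))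
        ≤ ∫ x in (0:ℝ)..1, 2 * (sol.ρ x T + sol.ρ x T * sol.θ x T) := by
      apply intervalIntegral.integral_mono_on zero_le_one ((cρ.mul cd).int hTT)
        (((cρ.add cρθ).cmul 2).int hTT)
      intro x hx
      have h1 := sol.ρ_pos x hx T hTT
      have h2 := sol.θ_pos x hx T hTT
      have h3 : sol.θ x T ^ (1 - α) ≤ 1 + sol.θ x T := by
        have := rpow_le_one_add (a := 1 - α) (q := 1) h2 (by linarith) (by linarith)
        rwa [Real.rpow_one] at this
      have h4 : sol.θ x T ^ (1 - α) / (1 - α) ≤ 2 * (1 + sol.θ x T) := by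
        rw [div_le_iff₀ (by linarith)]
        nlinarith
      calc _ ≤ sol.ρ x T * (2 * (1 + sol.θ x T)) := mul_le_mul_of_nonneg_left h4 h1.le
        _ = _ := by ring
    rw [intervalIntegral.integral_const_mul,
      intervalIntegral.integral_add (cρ.int hTT) (cρθ.int hTT), mass_int sol hTT] at this
    have := ρθ_le sol hκ hE hTT
    linarith
  -- left-hand side
  have ci : CQ T (fun x t => α * κ (sol.θ x t) * pdx sol.θ x t ^ 2 * sol.θ x t ^ (-α - 1)
        + Dis sol x t * sol.θ x t ^ (-α) - sol.ρ x t * sol.θ x t ^ (1 - α) * pdx sol.u x t) :=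
    (((((κθ_cq sol hκ).cmul α).mul (((sθ sol).pdx.cq T).pow 2)).mul (cp _)).add
      ((Dis_cq sol).mul (cp _))).sub ((cρ.mul (cp _)).mul ((su sol).pdx.cq T))
  have hl : ∫ t in (0:ℝ)..T, (α / C₀ / 2 * J sol t - R * E / 4 * (2 * ε * (E / M) + Cε)) ≤
      II T (fun x t => α * κ (sol.θ x t) * pdx sol.θ x t ^ 2 * sol.θ x t ^ (-α - 1)
        + Dis sol x t * sol.θ x t ^ (-α) - sol.ρ x t * sol.θ x t ^ (1 - α) * pdx sol.u x t) := by
    apply intervalIntegral.integral_mono_on hT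
      (((J_int sol hT).const_mul _).sub (by simp)) (ci.innerI hT)
    intro t ht
    set Θ := 2 * (E / M) + J sol t / 2 with hΘ
    have hΘθ : ∀ x ∈ Icc (0:ℝ) 1, sol.θ x t ≤ Θ :=
      fun x hx => θ_sup sol hκ hE hEp hM hm hx ht
    have hΘ0 : 0 ≤ Θ := (sol.θ_pos 0 (by simp) t ht).le.trans (hΘθ 0 (by simp))
    have step : ∫ x in (0:ℝ)..1, (α / C₀ * jd sol x t
          - R / 4 * (ε * Θ + Cε) * (sol.ρ x t * sol.θ x t)) ≤
        ∫ x in (0:ℝ)..1, (α * κ (sol.θ x t) * pdx sol.θ x t ^ 2 * sol.θ x t ^ (-α - 1)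
        + Dis sol x t * sol.θ x t ^ (-α) - sol.ρ x t * sol.θ x t ^ (1 - α) * pdx sol.u x t) := by
      apply intervalIntegral.integral_mono_on zero_le_one
        ((((jd_cq sol).cmul _).sub (cρθ.cmul _)).int ht) (ci.int ht)
      intro x hx
      have hρ := sol.ρ_pos x hx t ht
      have hθ := sol.θ_pos x hx t ht
      have hk := hκ.2.1 _ hθ.le
      have g1 : C₀⁻¹ * sol.θ x t ^ α ≤ κ (sol.θ x t) := by
        refine le_trans ?_ hk
        exact mul_le_mul_of_nonneg_left (rpow_le_one_add hθ hα.le hαq) (by positivity)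
      have g2 : sol.θ x t ^ α * sol.θ x t ^ (-α - 1) = (sol.θ x t)⁻¹ := by
        rw [← Real.rpow_add hθ, show α + (-α - 1) = -1 by ring, Real.rpow_neg_one]
      have g3 : α / C₀ * jd sol x t
          ≤ α * κ (sol.θ x t) * pdx sol.θ x t ^ 2 * sol.θ x t ^ (-α - 1) := by
        have hh : 0 ≤ α * pdx sol.θ x t ^ 2 * sol.θ x t ^ (-α - 1) := by positivity
        calc α / C₀ * jd sol x t
            = C₀⁻¹ * sol.θ x t ^ α * (α * pdx sol.θ x t ^ 2 * sol.θ x t ^ (-α - 1)) := by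
              unfold jd; rw [← g2]; ring
          _ ≤ κ (sol.θ x t) * (α * pdx sol.θ x t ^ 2 * sol.θ x t ^ (-α - 1)) :=
              mul_le_mul_of_nonneg_right g1 hh
          _ = _ := by ring
      have g4 : sol.θ x t ^ (1 - α) = sol.θ x t * sol.θ x t ^ (-α) := by
        rw [show 1 - α = 1 + -α by ring, Real.rpow_add hθ, Real.rpow_one]
      have hp : 0 < sol.θ x t ^ (-α) := by positivity
      have g5 : sol.ρ x t * sol.θ x t ^ (1 - α) * pdx sol.u x t
          ≤ Dis sol x t * sol.θ x t ^ (-α)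
            + 1 / 4 * sol.ρ x t * (sol.ρ x t * sol.θ x t) * sol.θ x t ^ (1 - α) := by
        have d1 := mul_le_mul_of_nonneg_right (Dis_ge sol x t) hp.le
        have d2 : 0 ≤ sol.θ x t ^ (-α) * (pdx sol.u x t - sol.ρ x t * sol.θ x t / 2) ^ 2 := by
          positivity
        rw [g4]
        nlinarith
      have g6 : sol.θ x t ^ (1 - α) ≤ ε * Θ + Cε := by
        refine (hY _ hθ).trans ?_
        have := mul_le_mul_of_nonneg_left (hΘθ x hx) hε.le
        linarith
      have g7 : 1 / 4 * sol.ρ x t * (sol.ρ x t * sol.θ x t) * sol.θ x t ^ (1 - α)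
          ≤ R / 4 * (ε * Θ + Cε) * (sol.ρ x t * sol.θ x t) := by
        have hρθ : 0 ≤ sol.ρ x t * sol.θ x t := by positivity
        have := mul_le_mul (hR x hx t ht) g6 (by positivity) hRp
        have := mul_le_mul_of_nonneg_right this hρθ
        linarith
      linarith
    rw [intervalIntegral.integral_sub (((jd_cq sol).cmul _).int ht) ((cρθ.cmul _).int ht),
      intervalIntegral.integral_const_mul, intervalIntegral.integral_const_mul] at step
    refine le_trans ?_ step
    have hρθ := ρθ_le sol hκ hE ht
    have hco : 0 ≤ R / 4 * (ε * Θ + Cε) := by positivity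
    have s1 := mul_le_mul_of_nonneg_left hρθ hco
    have hJ : 0 ≤ J sol t := by
      apply intervalIntegral.integral_nonneg zero_le_one
      intro x hx
      have hθ := sol.θ_pos x hx t ht
      unfold jd; positivity
    have s2 := mul_le_mul_of_nonneg_right hεR hJ
    change _ ≤ α / C₀ * J sol t - _
    have e : R / 4 * (ε * Θ + Cε) * E
      = R * E / 4 * (2 * ε * (E / M) + Cε) + R * E * ε / 8 * J sol t := by rw [hΘ]; ring
    linarith
  rw [hw, intervalIntegral.integral_sub ((J_int sol hT).const_mul _) (by simp),
    intervalIntegral.integral_const_mul] at hl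
  simp only [intervalIntegral.integral_const, sub_zero, smul_eq_mul] at hl
  linarith

lemma Dis_bound {q C₀ E M R : ℝ} (hT : 0 ≤ T) (hκ : KappaHyp q C₀ κ)
    (hE : E0 sol ≤ E) (hEp : 0 ≤ E) (hM : 0 < M)
    (hm : M ≤ ∫ x in (0:ℝ)..1, sol.ρ x 0)
    (hRp : 0 ≤ R) (hR : ∀ x ∈ Icc (0:ℝ) 1, ∀ t ∈ Icc (0:ℝ) T, sol.ρ x t ≤ R) :
    II T (Dis sol) ≤ 2 * E + R * E * (2 * (E / M) * T + (∫ t in (0:ℝ)..T, J sol t) / 2) := by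
  have hTT : T ∈ Icc (0:ℝ) T := ⟨hT, le_rfl⟩
  have h0T : (0:ℝ) ∈ Icc (0:ℝ) T := ⟨le_rfl, hT⟩
  have hk := kin_int sol hTT
  have k1 : 0 ≤ ∫ x in (0:ℝ)..1, Kin sol x T :=
    intervalIntegral.integral_nonneg zero_le_one (fun x hx => Kin_nonneg sol hx hTT)
  have k2 := Kin_le sol hκ hE h0T
  have cρθ := ρθ_cq sol
  have cD := Dis_cq sol
  have ci : CQ T (fun x t => sol.ρ x t * sol.θ x t * pdx sol.u x t - Dis sol x t) :=
    (cρθ.mul ((su sol).pdx.cq T)).sub cD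
  have iJ : IntervalIntegrable (fun t => R * E / 2 * (2 * (E / M) + J sol t / 2)) volume 0 T :=
    (IntervalIntegrable.add (by simp) ((J_int sol hT).div_const 2)).const_mul _
  have iD : IntervalIntegrable (fun t => -(1/2) * ∫ x in (0:ℝ)..1, Dis sol x t) volume 0 T :=
    (cD.innerI hT).const_mul _
  have hl : II T (fun x t => sol.ρ x t * sol.θ x t * pdx sol.u x t - Dis sol x t) ≤
      ∫ t in (0:ℝ)..T, ((-(1/2) * ∫ x in (0:ℝ)..1, Dis sol x t)
        + R * E / 2 * (2 * (E / M) + J sol t / 2)) := by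
    apply intervalIntegral.integral_mono_on hT (ci.innerI hT) (iD.add iJ)
    intro t ht
    set Θ := 2 * (E / M) + J sol t / 2 with hΘ
    have hΘθ : ∀ x ∈ Icc (0:ℝ) 1, sol.θ x t ≤ Θ :=
      fun x hx => θ_sup sol hκ hE hEp hM hm hx ht
    have hΘ0 : 0 ≤ Θ := (sol.θ_pos 0 (by simp) t ht).le.trans (hΘθ 0 (by simp))
    have step : ∫ x in (0:ℝ)..1, (sol.ρ x t * sol.θ x t * pdx sol.u x t - Dis sol x t)
        ≤ ∫ x in (0:ℝ)..1, (-(1/2) * Dis sol x t + R / 2 * Θ * (sol.ρ x t * sol.θ x t)) := by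
      apply intervalIntegral.integral_mono_on zero_le_one (ci.int ht)
        (((cD.cmul _).add (cρθ.cmul _)).int ht)
      intro x hx
      have hρ := sol.ρ_pos x hx t ht
      have hθ := sol.θ_pos x hx t ht
      have hρθ : 0 ≤ sol.ρ x t * sol.θ x t := by positivity
      have d1 := Dis_ge sol x t
      have d2 := mul_le_mul (hR x hx t ht) (hΘθ x hx) hθ.le hRp
      have d3 := mul_le_mul_of_nonneg_right d2 hρθ
      nlinarith [sq_nonneg (pdx sol.u x t - sol.ρ x t * sol.θ x t)]
    rw [intervalIntegral.integral_add ((cD.cmul _).int ht) ((cρθ.cmul _).int ht),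
      intervalIntegral.integral_const_mul, intervalIntegral.integral_const_mul] at step
    refine step.trans ?_
    have hρθ := ρθ_le sol hκ hE ht
    have hco : 0 ≤ R / 2 * Θ := by positivity
    have s1 := mul_le_mul_of_nonneg_left hρθ hco
    linarith
  rw [hk, intervalIntegral.integral_add iD iJ, intervalIntegral.integral_const_mul,
    intervalIntegral.integral_const_mul,
    intervalIntegral.integral_add (by simp) ((J_int sol hT).div_const 2),
    intervalIntegral.integral_div] at hl
  simp only [intervalIntegral.integral_const, sub_zero, smul_eq_mul] at hl
  change _ ≤ -(1/2) * II T (Dis sol) + _ at hl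
  nlinarith

lemma slice_smooth {f : ℝ → ℝ → ℝ} (hf : Sm f) (t : ℝ) :
    ContDiff ℝ (⊤ : ℕ∞) (fun x => f x t) :=
  ContDiff.comp (g := Function.uncurry f) (f := fun x : ℝ => (x, t)) hf (by fun_prop)

lemma init_bounds {A B M : ℝ} (hT : 0 ≤ T) (h : InitBounds sol A B M) :
    (∀ x ∈ Icc (0:ℝ) 1, sol.ρ x 0 ≤ 1 + 2 * A ^ 2) ∧
    (∫ x in (0:ℝ)..1, sol.ρ x 0) ≤ 1 + 2 * A ^ 2 ∧
    E0 sol ≤ 5 * (1 + 2 * A ^ 2) ^ 2 := by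
  obtain ⟨hρ, hu, hθ, hw, hb, -, -⟩ := h
  have h0T : (0:ℝ) ∈ Icc (0:ℝ) T := ⟨le_rfl, hT⟩
  have bρ := H2_sup (slice_smooth (sρ sol) 0) hρ
  have bu := H2_sup (slice_smooth (su sol) 0) hu
  have bθ := H2_sup (slice_smooth (sθ sol) 0) hθ
  have bw := fun i => H2_sup (slice_smooth (sw sol i) 0) (hw i)
  have bb := fun i => H2_sup (slice_smooth (sb sol i) 0) (hb i)
  have b1 : ∀ x ∈ Icc (0:ℝ) 1, sol.ρ x 0 ≤ 1 + 2 * A ^ 2 := by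
    intro x hx
    have := bρ x hx
    nlinarith [sq_nonneg (sol.ρ x 0 - 1)]
  have b2 : ∀ x ∈ Icc (0:ℝ) 1, sol.θ x 0 ≤ 1 + 2 * A ^ 2 := by
    intro x hx
    have := bθ x hx
    nlinarith [sq_nonneg (sol.θ x 0 - 1)]
  refine ⟨b1, ?_, ?_⟩
  · have := intervalIntegral.integral_mono_on zero_le_one (((sρ sol).cq T).int h0T)
      (by simp : IntervalIntegrable (fun _ => 1 + 2 * A ^ 2) volume 0 1) b1
    simpa using this
  · unfold E0
    rw [← intervalIntegral.integral_add (((Kin_sm sol).cq T).int h0T) ((ρθ_cq sol).int h0T)]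
    have := intervalIntegral.integral_mono_on zero_le_one
      ((((Kin_sm sol).cq T).add (ρθ_cq sol)).int h0T)
      (by simp : IntervalIntegrable (fun _ => 5 * (1 + 2 * A ^ 2) ^ 2) volume 0 1) (by
        intro x hx
        have hρ0 := (sol.ρ_pos x hx 0 h0T).le
        have hθ0 := (sol.θ_pos x hx 0 h0T).le
        have hL : 0 ≤ 2 * A ^ 2 := by positivity
        have m1 := mul_le_mul (b1 x hx) (bu x hx) (by positivity) (by positivity)
        have m2 := mul_le_mul (b1 x hx) (bw 0 x hx) (by positivity) (by positivity)
        have m3 := mul_le_mul (b1 x hx) (bw 1 x hx) (by positivity) (by positivity)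
        have m4 := mul_le_mul (b1 x hx) (b2 x hx) hθ0 (by positivity)
        have m5 := bb 0 x hx
        have m6 := bb 1 x hx
        unfold Kin
        set L := 2 * A ^ 2
        nlinarith)
    simpa using this

end temp

/-- Lemma 2.4: there is a constant `C` depending only on `T, q, C₀`
and on the initial data (upper bound `A` for the `H²` norms, upper bound `B` for
`∫₀¹ ρ₀(|ln ρ₀| + |ln θ₀|) dx`, positive lower bound `M` for `∫₀¹ ρ₀ dx`), but not on
the pointwise lower bounds of `ρ₀` and `θ₀`, such that every smooth solution satisfies
`∬_{Q_T} (u_x² + |w_x|² + |b_x|²) dx dt ≤ C`. -/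
theorem stmt11 (T q C₀ : ℝ) (hT : 0 < T) (hq : 0 < q) (hC₀ : 1 ≤ C₀)
    (κ : ℝ → ℝ) (hκ : KappaHyp q C₀ κ) (A B M : ℝ) (hM : 0 < M) :
    ∃ C : ℝ, 0 < C ∧ ∀ sol : MHDSol T κ, InitBounds sol A B M →
      (∫ s in (0:ℝ)..T, ∫ y in (0:ℝ)..1,
          (pdx sol.u y s) ^ 2 + (∑ i, (pdx (sol.w i) y s) ^ 2)
          + (∑ i, (pdx (sol.b i) y s) ^ 2)) ≤ C := by
  have hC0 : 0 < C₀ := by linarith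
  obtain ⟨N0, hN0⟩ : ∃ N0 : ℝ, N0 = 1 + 2 * A ^ 2 := ⟨_, rfl⟩
  obtain ⟨E, hE⟩ : ∃ E : ℝ, E = 5 * (1 + 2 * A ^ 2) ^ 2 := ⟨_, rfl⟩
  have hN0p : 0 < N0 := by rw [hN0]; positivity
  have hEp : 0 < E := by rw [hE]; positivity
  obtain ⟨R, hR⟩ : ∃ R : ℝ, R = N0 * Real.exp (4 * (N0 / 2 + E) + 2 * E * T) := ⟨_, rfl⟩
  have hRp : 0 < R := by rw [hR]; positivity
  obtain ⟨α, hα⟩ : ∃ α : ℝ, α = min q (1 / 2) := ⟨_, rfl⟩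
  have hαp : 0 < α := by rw [hα]; exact lt_min hq (by norm_num)
  have hα1 : α ≤ 1 / 2 := by rw [hα]; exact min_le_right _ _
  have hαq : α ≤ q := by rw [hα]; exact min_le_left _ _
  obtain ⟨ε, hε⟩ : ∃ ε : ℝ, ε = 4 * (α / C₀) / (R * E) := ⟨_, rfl⟩
  have hεp : 0 < ε := by rw [hε]; positivity
  have hεR : R * E * ε / 8 ≤ α / C₀ / 2 := by
    rw [hε]; apply le_of_eq; field_simp; norm_num
  obtain ⟨Cε, hCε, hY⟩ := rpow_young hαp (by linarith) hεp
  obtain ⟨CJ, hCJ⟩ : ∃ CJ : ℝ, CJ =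
    (2 * (N0 + E) + R * E / 4 * (2 * ε * (E / M) + Cε) * T) / (α / C₀ / 2) := ⟨_, rfl⟩
  have hCJp : 0 < CJ := by rw [hCJ]; positivity
  refine ⟨2 * E + R * E * (2 * (E / M) * T + CJ / 2), by positivity, ?_⟩
  intro sol hI
  obtain ⟨i1, i2, i3⟩ := init_bounds sol hT.le hI
  rw [← hN0] at i1 i2
  rw [← hE] at i3
  have hm : M ≤ ∫ x in (0:ℝ)..1, sol.ρ x 0 := hI.2.2.2.2.2.2
  have hρR := ρ_bound sol hT.le hκ i3 i2 i1 hEp.le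
  rw [← hR] at hρR
  have hJ := J_bound sol hT.le hC₀ hκ i3 hEp.le hM hm i2 hRp.le hρR hαp hα1 hαq hεp hCε hY hεR
  have hJ2 : ∫ t in (0:ℝ)..T, J sol t ≤ CJ := by
    rw [hCJ, le_div_iff₀ (by positivity)]
    linarith
  have hD := Dis_bound sol hT.le hκ i3 hEp.le hM hm hRp.le hρR
  have hRE : 0 < R * E := by positivity
  refine le_trans hD ?_
  have := mul_le_mul_of_nonneg_left hJ2 hRE.le
  linarith
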